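/- arXiv:2505.09206 — 9 statements merged into one kernel-verified Lean document; each statement's English description precedes it below -/
import Mathlib

section
/- Let O be a d×d Hermitian complex matrix with O² = I (a dichotomic observable), and let P₊ = (I + O)/2 and P₋ = (I − O)/2 be the orthogonal projectors onto its +1 and −1 eigenspaces. Then for every d×d complex matrix ρ, Tr(O ρ²) = Tr((P₊ ρ P₊)²) − Tr((P₋ ρ P₋)²). -/
open Matrix

/-- The trace of the square of the compression `P ρ P` by an idempotent `P`. -/
theorem trace_compression_mul_self {n R : Type*} [Fintype n] [CommRing R]
    {P : Matrix n n R} (hP : P * P = P) (ρ : Matrix n n R) :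
    trace ((P * ρ * P) * (P * ρ * P)) = trace (P * ρ * (P * ρ)) := by
  have h : (P * ρ * P) * (P * ρ * P) = P * ρ * (P * P) * ρ * P := by
    simp only [Matrix.mul_assoc]
  rw [h, hP, trace_mul_comm]
  simp only [← Matrix.mul_assoc, hP]

/-- Half of `1 + A` is idempotent when `A` is an involution. -/
theorem half_one_add_mul_self {n : Type*} [Fintype n] [DecidableEq n]
    {A : Matrix n n ℂ} (hA : A * A = 1) :
    ((1 / 2 : ℂ) • (1 + A)) * ((1 / 2 : ℂ) • (1 + A)) = (1 / 2 : ℂ) • (1 + A) := by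
  simp only [smul_mul_smul_comm, add_mul, mul_add, one_mul, mul_one, hA]
  module

/-- The trace of the squared compression by the `+1` projector of an involution, expanded. -/
theorem trace_half_one_add_compression {n : Type*} [Fintype n] [DecidableEq n]
    {A : Matrix n n ℂ} (hA : A * A = 1) (ρ : Matrix n n ℂ) :
    trace ((((1 / 2 : ℂ) • (1 + A)) * ρ * ((1 / 2 : ℂ) • (1 + A))) *
           (((1 / 2 : ℂ) • (1 + A)) * ρ * ((1 / 2 : ℂ) • (1 + A)))) =
      (1 / 4) * (trace (ρ * ρ) + 2 * trace (A * (ρ * ρ)) + trace (A * ρ * (A * ρ))) := by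
  have h : trace (ρ * (A * ρ)) = trace (A * (ρ * ρ)) := by
    rw [trace_mul_comm, Matrix.mul_assoc]
  rw [trace_compression_mul_self (half_one_add_mul_self hA)]
  simp only [smul_mul_assoc, mul_smul_comm, add_mul, mul_add, one_mul, trace_smul, trace_add,
    smul_eq_mul, h, Matrix.mul_assoc]
  ring

/-- For a dichotomic observable `O` (Hermitian with `O² = 1`) with
eigenprojectors `P₊ = (1 + O)/2` and `P₋ = (1 - O)/2`, and any matrix `ρ`,
`Tr(O ρ²) = Tr((P₊ ρ P₊)²) - Tr((P₋ ρ P₋)²)`. -/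
theorem dichotomic_trace_split {d : ℕ} (O ρ : Matrix (Fin d) (Fin d) ℂ)
    (hO : O.IsHermitian) (hO2 : O * O = 1) :
    trace (O * (ρ * ρ)) =
      trace ((((1 / 2 : ℂ) • (1 + O)) * ρ * ((1 / 2 : ℂ) • (1 + O))) *
             (((1 / 2 : ℂ) • (1 + O)) * ρ * ((1 / 2 : ℂ) • (1 + O)))) -
      trace ((((1 / 2 : ℂ) • (1 - O)) * ρ * ((1 / 2 : ℂ) • (1 - O))) *
             (((1 / 2 : ℂ) • (1 - O)) * ρ * ((1 / 2 : ℂ) • (1 - O)))) := by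
  have h := trace_half_one_add_compression (A := -O) (by rw [neg_mul_neg, hO2]) ρ
  simp only [← sub_eq_add_neg, neg_mul, mul_neg, neg_neg, trace_neg] at h
  rw [trace_half_one_add_compression hO2, h]
  ring
end

section
/- Let O be a d×d dichotomic observable whose +1 and −1 eigenspaces have dimensions d₊ = rank((I+O)/2) and d₋ = rank((I−O)/2), and suppose d₊ ≥ 1, d₋ ≥ 1, and min{d₊, d₋} < d/4. Then there exist a sign s ∈ {+1, −1} and dichotomic observables O₁, O₂, O₃ (Hermitian d×d matrices with Oᵢ² = I) such that O = (1/2)(s·I + O₁ + O₂ + O₃), and for each i ∈ {1,2,3} both eigenspace dimensions of Oᵢ are at least d/3, i.e., 3·rank((I+Oᵢ)/2) ≥ d and 3·rank((I−Oᵢ)/2) ≥ d. -/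
open Matrix

lemma Finset.exists_balanced_three_partition {n : Type*} [DecidableEq n] (T : Finset n) :
    ∃ A B C : Finset n, A ⊆ T ∧ B ⊆ T ∧ C ⊆ T ∧
      (∀ i ∈ T, (i ∈ A ∧ i ∉ B ∧ i ∉ C) ∨ (i ∉ A ∧ i ∈ B ∧ i ∉ C) ∨ (i ∉ A ∧ i ∉ B ∧ i ∈ C)) ∧
      ∀ X ∈ [A, B, C], T.card ≤ 3 * X.card + 2 ∧ 3 * X.card ≤ T.card + 2 := by
  obtain ⟨A, hA, hAc⟩ := Finset.exists_subset_card_eq (s := T) (n := T.card / 3) (by omega)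
  have h1 := Finset.card_sdiff_of_subset hA
  obtain ⟨B, hB, hBc⟩ :=
    Finset.exists_subset_card_eq (s := T \ A) (n := (T \ A).card / 2) (by omega)
  have h2 := Finset.card_sdiff_of_subset hB
  refine ⟨A, B, (T \ A) \ B, hA, hB.trans Finset.sdiff_subset,
    Finset.sdiff_subset.trans Finset.sdiff_subset, ?_, ?_⟩
  · intro i hi
    have := @hB i
    simp only [Finset.mem_sdiff] at this ⊢
    tauto
  · simp only [List.mem_cons, List.not_mem_nil, or_false, forall_eq_or_imp, forall_eq]
    omega

section SignedReflection

variable {n : Type*} [Fintype n] [DecidableEq n]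

/-- The dichotomic observable that is diagonal in the orthonormal basis given by the columns of `U`,
with eigenvalue `-1` on the columns indexed by `A` and `1` on the others. -/
def signedReflection (U : unitaryGroup n ℂ) (A : Finset n) : Matrix n n ℂ :=
  U.1 * diagonal (fun i => if i ∈ A then -1 else 1) * star U.1

lemma unitary_conj_one (U : unitaryGroup n ℂ) :
    U.1 * diagonal (fun _ => (1 : ℂ)) * star U.1 = 1 := by
  simp

lemma rank_unitary_conj_diagonal (U : unitaryGroup n ℂ) (v : n → ℂ) :
    (U.1 * diagonal v * star U.1).rank = (Finset.univ.filter fun i => v i ≠ 0).card := by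
  have h : IsUnit U.1.det := (Matrix.isUnit_iff_isUnit_det _).1 (Unitary.toUnits U).isUnit
  have h' : IsUnit (star U.1).det :=
    (Matrix.isUnit_iff_isUnit_det _).1 (Unitary.toUnits (star U)).isUnit
  rw [rank_mul_eq_left_of_isUnit_det _ _ h', rank_mul_eq_right_of_isUnit_det _ _ h,
    rank_diagonal, Fintype.card_subtype]

lemma signedReflection_isHermitian (U : unitaryGroup n ℂ) (A : Finset n) :
    (signedReflection U A).IsHermitian := by
  refine isHermitian_mul_mul_conjTranspose U.1 ?_
  refine isHermitian_diagonal_of_self_adjoint _ ?_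
  ext i
  by_cases h : i ∈ A <;> simp [h]

lemma signedReflection_mul_self (U : unitaryGroup n ℂ) (A : Finset n) :
    signedReflection U A * signedReflection U A = 1 := by
  have hU : star U.1 * U.1 = 1 := Unitary.coe_star_mul_self U
  have hD : diagonal (fun i => if i ∈ A then (-1 : ℂ) else 1) *
      diagonal (fun i => if i ∈ A then (-1 : ℂ) else 1) = 1 := by
    rw [diagonal_mul_diagonal, ← diagonal_one]
    congr 1
    ext i
    split_ifs <;> simp
  rw [signedReflection]
  simp only [Matrix.mul_assoc]
  rw [← Matrix.mul_assoc (star U.1) U.1, hU, Matrix.one_mul, ← Matrix.mul_assoc (diagonal _), hD,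
    Matrix.one_mul]
  exact Unitary.coe_mul_star_self U

lemma rank_half_one_sub_signedReflection (U : unitaryGroup n ℂ) (A : Finset n) :
    ((1 / 2 : ℂ) • (1 - signedReflection U A)).rank = A.card := by
  have h : (1 / 2 : ℂ) • (1 - signedReflection U A) =
      U.1 * diagonal (fun i => if i ∈ A then (1 : ℂ) else 0) * star U.1 := by
    rw [signedReflection]
    nth_rw 1 [← unitary_conj_one U]
    rw [← Matrix.sub_mul, ← Matrix.mul_sub, diagonal_sub, ← Matrix.smul_mul, ← Matrix.mul_smul,
      ← diagonal_smul]
    congr 3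
    ext i
    by_cases hi : i ∈ A <;> simp [hi, one_add_one_eq_two]
  rw [h, rank_unitary_conj_diagonal]
  simp

lemma rank_half_one_add_signedReflection (U : unitaryGroup n ℂ) (A : Finset n) :
    ((1 / 2 : ℂ) • (1 + signedReflection U A)).rank = Aᶜ.card := by
  have h : (1 / 2 : ℂ) • (1 + signedReflection U A) =
      U.1 * diagonal (fun i => if i ∈ A then (0 : ℂ) else 1) * star U.1 := by
    rw [signedReflection]
    nth_rw 1 [← unitary_conj_one U]
    rw [← Matrix.add_mul, ← Matrix.mul_add, diagonal_add, ← Matrix.smul_mul, ← Matrix.mul_smul,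
      ← diagonal_smul]
    congr 3
    ext i
    by_cases hi : i ∈ A <;> simp [hi, one_add_one_eq_two]
  rw [h, rank_unitary_conj_diagonal]
  congr 1
  ext i
  simp

lemma exists_eq_signedReflection {O : Matrix n n ℂ} (hO : O.IsHermitian) (hO2 : O * O = 1) :
    ∃ (U : unitaryGroup n ℂ) (A : Finset n), O = signedReflection U A := by
  have hs : O = hO.eigenvectorUnitary.1 * diagonal (RCLike.ofReal ∘ hO.eigenvalues) *
      star hO.eigenvectorUnitary.1 := by
    simpa [Unitary.conjStarAlgAut_apply] using hO.spectral_theorem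
  have hv : ∀ i, hO.eigenvalues i = 1 ∨ hO.eigenvalues i = -1 := by
    intro i
    have h1 := hO.mulVec_eigenvectorBasis i
    have h2 : O *ᵥ (O *ᵥ (hO.eigenvectorBasis i).ofLp) = (hO.eigenvectorBasis i).ofLp := by
      rw [mulVec_mulVec, hO2, one_mulVec]
    rw [h1, mulVec_smul, h1, smul_smul] at h2
    have h0 : (hO.eigenvectorBasis i).ofLp ≠ 0 := by
      simpa using hO.eigenvectorBasis.orthonormal.ne_zero i
    exact mul_self_eq_one_iff.1 (smul_left_injective ℝ h0 (by simpa using h2))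
  refine ⟨hO.eigenvectorUnitary, Finset.univ.filter fun i => hO.eigenvalues i = -1, ?_⟩
  rw [signedReflection]
  refine hs.trans ?_
  congr 3
  ext i
  rcases hv i with h | h <;> simp [h]
  norm_num

/-- Splitting the complement of `S` into three parts `A`, `B`, `C` decomposes the reflection
with negative part `S`. -/
lemma signedReflection_eq_half_sum (U : unitaryGroup n ℂ) {S A B C : Finset n}
    (h : ∀ i, i ∉ S → (i ∈ A ∧ i ∉ B ∧ i ∉ C) ∨ (i ∉ A ∧ i ∈ B ∧ i ∉ C) ∨
      (i ∉ A ∧ i ∉ B ∧ i ∈ C)) :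
    signedReflection U S = (1 / 2 : ℂ) • ((1 : ℂ) • (1 : Matrix n n ℂ) +
      signedReflection U (S ∪ A) + signedReflection U (S ∪ B) + signedReflection U (S ∪ C)) := by
  simp only [signedReflection, one_smul]
  nth_rw 1 [← unitary_conj_one U]
  simp only [← Matrix.add_mul, ← Matrix.mul_add, diagonal_add]
  rw [← Matrix.smul_mul, ← Matrix.mul_smul, ← diagonal_smul]
  congr 3
  ext i
  by_cases hi : i ∈ S
  · simp [hi]
    norm_num
  · rcases h i hi with ⟨hA, hB, hC⟩ | ⟨hA, hB, hC⟩ | ⟨hA, hB, hC⟩ <;>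
      simp [hi, hA, hB, hC, one_add_one_eq_two]

end SignedReflection

/-- The case of a `-1` eigenspace of dimension less than a quarter, where the sign is `1`. -/
lemma dichotomic_decomposition_of_small_neg {d : ℕ} (O : Matrix (Fin d) (Fin d) ℂ)
    (hO : O.IsHermitian) (hO2 : O * O = 1)
    (hdm : 1 ≤ ((1 / 2 : ℂ) • (1 - O)).rank)
    (hmin : 4 * ((1 / 2 : ℂ) • (1 - O)).rank < d) :
    ∃ O₁ O₂ O₃ : Matrix (Fin d) (Fin d) ℂ,
      O = (1 / 2 : ℂ) • ((1 : ℂ) • (1 : Matrix (Fin d) (Fin d) ℂ) + O₁ + O₂ + O₃) ∧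
      ∀ Oi ∈ [O₁, O₂, O₃],
        Oi.IsHermitian ∧ Oi * Oi = 1 ∧
        d ≤ 3 * ((1 / 2 : ℂ) • (1 + Oi)).rank ∧
        d ≤ 3 * ((1 / 2 : ℂ) • (1 - Oi)).rank := by
  obtain ⟨U, S, rfl⟩ := exists_eq_signedReflection hO hO2
  rw [rank_half_one_sub_signedReflection] at hdm hmin
  obtain ⟨A, B, C, hA, hB, hC, hABC, hcard⟩ := Finset.exists_balanced_three_partition Sᶜ
  have key : ∀ X ⊆ Sᶜ, (Sᶜ.card ≤ 3 * X.card + 2 ∧ 3 * X.card ≤ Sᶜ.card + 2) →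
      (signedReflection U (S ∪ X)).IsHermitian ∧
      signedReflection U (S ∪ X) * signedReflection U (S ∪ X) = 1 ∧
      d ≤ 3 * ((1 / 2 : ℂ) • (1 + signedReflection U (S ∪ X))).rank ∧
      d ≤ 3 * ((1 / 2 : ℂ) • (1 - signedReflection U (S ∪ X))).rank := by
    intro X hX hXc
    refine ⟨signedReflection_isHermitian _ _, signedReflection_mul_self _ _, ?_⟩
    rw [rank_half_one_add_signedReflection, rank_half_one_sub_signedReflection]
    have h1 : (S ∪ X).card = S.card + X.card :=
      Finset.card_union_of_disjoint (disjoint_compl_right.mono_right hX)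
    have h2 := Finset.card_add_card_compl S
    have h3 := Finset.card_add_card_compl (S ∪ X)
    rw [Fintype.card_fin] at h2 h3
    omega
  refine ⟨_, _, _, signedReflection_eq_half_sum U (A := A) (B := B) (C := C)
    fun i hi => hABC i (Finset.mem_compl.2 hi), ?_⟩
  simp only [List.mem_cons, List.not_mem_nil, or_false, forall_eq_or_imp, forall_eq] at hcard ⊢
  exact ⟨key A hA hcard.1, key B hB hcard.2.1, key C hC hcard.2.2⟩

/-- Any dichotomic observable `O` whose eigenspace dimensions
`d₊ = rank((1+O)/2)`, `d₋ = rank((1-O)/2)` are nonzero and satisfy `min{d₊, d₋} < d/4`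
can be written as `O = (1/2)(s·I + O₁ + O₂ + O₃)` with `s = ±1` and each `Oᵢ` a dichotomic
observable with both eigenspace dimensions at least `d/3`. -/
theorem dichotomic_decomposition {d : ℕ} (O : Matrix (Fin d) (Fin d) ℂ)
    (hO : O.IsHermitian) (hO2 : O * O = 1)
    (hdp : 1 ≤ ((1 / 2 : ℂ) • (1 + O)).rank)
    (hdm : 1 ≤ ((1 / 2 : ℂ) • (1 - O)).rank)
    (hmin : 4 * min (((1 / 2 : ℂ) • (1 + O)).rank) (((1 / 2 : ℂ) • (1 - O)).rank) < d) :
    ∃ (s : ℂ) (O₁ O₂ O₃ : Matrix (Fin d) (Fin d) ℂ),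
      (s = 1 ∨ s = -1) ∧
      O = (1 / 2 : ℂ) • (s • (1 : Matrix (Fin d) (Fin d) ℂ) + O₁ + O₂ + O₃) ∧
      ∀ Oi ∈ [O₁, O₂, O₃],
        Oi.IsHermitian ∧ Oi * Oi = 1 ∧
        d ≤ 3 * ((1 / 2 : ℂ) • (1 + Oi)).rank ∧
        d ≤ 3 * ((1 / 2 : ℂ) • (1 - Oi)).rank := by
  rcases le_total ((1 / 2 : ℂ) • (1 - O)).rank ((1 / 2 : ℂ) • (1 + O)).rank with h | h
  · rw [min_eq_right h] at hmin
    obtain ⟨O₁, O₂, O₃, hsum, hall⟩ :=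
      dichotomic_decomposition_of_small_neg O hO hO2 hdm hmin
    exact ⟨1, O₁, O₂, O₃, Or.inl rfl, hsum, hall⟩
  · rw [min_eq_left h] at hmin
    obtain ⟨O₁, O₂, O₃, hsum, hall⟩ :=
      dichotomic_decomposition_of_small_neg (-O) hO.neg (by simpa using hO2)
        (by simpa only [sub_neg_eq_add] using hdp) (by simpa only [sub_neg_eq_add] using hmin)
    refine ⟨-1, -O₁, -O₂, -O₃, Or.inr rfl, ?_, ?_⟩
    · rw [← neg_neg O, hsum, ← smul_neg]
      congr 1
      rw [neg_smul]
      abel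
    · have hneg : ∀ P : Matrix (Fin d) (Fin d) ℂ,
          (P.IsHermitian ∧ P * P = 1 ∧ d ≤ 3 * ((1 / 2 : ℂ) • (1 + P)).rank ∧
            d ≤ 3 * ((1 / 2 : ℂ) • (1 - P)).rank) →
          (-P).IsHermitian ∧ -P * -P = 1 ∧ d ≤ 3 * ((1 / 2 : ℂ) • (1 + -P)).rank ∧
            d ≤ 3 * ((1 / 2 : ℂ) • (1 - -P)).rank := by
        rintro P ⟨hP, hP2, hp, hm⟩
        rw [neg_mul_neg, ← sub_eq_add_neg, sub_neg_eq_add]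
        exact ⟨hP.neg, hP2, hm, hp⟩
      simp only [List.mem_cons, List.not_mem_nil, or_false, forall_eq_or_imp, forall_eq] at hall ⊢
      exact ⟨hneg _ hall.1, hneg _ hall.2.1, hneg _ hall.2.2⟩
end

section
/- Let O be a d×d Hermitian complex matrix with ℓ²→ℓ² operator norm ‖O‖∞ ≤ 1, and let k be a positive integer. Then there exist dichotomic observables O₁, …, O_k (Hermitian d×d matrices with O_l² = I for each l) and a Hermitian d×d matrix O_Δ with ‖O_Δ‖∞ ≤ 2^{−k} such that O = Σ_{l=1}^{k} 2^{−l} O_l + O_Δ. -/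
open Matrix

/-- The ℓ²→ℓ² operator norm of a square complex matrix. -/
noncomputable def l2OpNorm {d : ℕ} (A : Matrix (Fin d) (Fin d) ℂ) : ℝ :=
  ‖Matrix.toEuclideanCLM (𝕜 := ℂ) (n := Fin d) A‖

open scoped Matrix.Norms.L2Operator in
/-- The ℓ²→ℓ² operator norm of a real diagonal matrix is unchanged by unitary conjugation. -/
lemma l2OpNorm_conjStarAlgAut_diagonal {d : ℕ} (U : unitary (Matrix (Fin d) (Fin d) ℂ))
    (v : Fin d → ℝ) :
    l2OpNorm (Unitary.conjStarAlgAut ℂ _ U (diagonal fun i => (v i : ℂ))) = ‖v‖ := by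
  have h (A : Matrix (Fin d) (Fin d) ℂ) : l2OpNorm A = ‖A‖ := rfl
  rw [h, Unitary.conjStarAlgAut_apply, ← Unitary.coe_star, CStarRing.norm_mul_coe_unitary,
    CStarRing.norm_coe_unitary_mul, Matrix.l2_opNorm_diagonal]
  simp [Pi.norm_def]

/-- A unitary conjugate of a real diagonal matrix is Hermitian. -/
lemma isHermitian_conjStarAlgAut_diagonal {d : ℕ} (U : unitary (Matrix (Fin d) (Fin d) ℂ))
    (v : Fin d → ℝ) :
    (Unitary.conjStarAlgAut ℂ _ U (diagonal fun i => (v i : ℂ))).IsHermitian := by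
  have h : IsSelfAdjoint (diagonal fun i => (v i : ℂ)) :=
    isHermitian_diagonal_of_self_adjoint _ (funext fun i => Complex.conj_ofReal (v i))
  exact h.map (Unitary.conjStarAlgAut ℂ _ U)

/-- Signed binary expansion, with `k` digits `±1`, of a real number in `[-1, 1]`. -/
lemma exists_signed_binary_expansion (k : ℕ) {x : ℝ} (hx : |x| ≤ 1) :
    ∃ s : Fin k → ℝ, (∀ l, s l * s l = 1) ∧
      |x - ∑ l, ((2 : ℝ) ^ (l.val + 1))⁻¹ * s l| ≤ ((2 : ℝ) ^ k)⁻¹ := by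
  induction k generalizing x with
  | zero => exact ⟨fun _ => 1, by simp, by simpa using hx⟩
  | succ k ih =>
    obtain ⟨e, he, hxe⟩ : ∃ e : ℝ, e * e = 1 ∧ |2 * x - e| ≤ 1 := by
      rw [abs_le] at hx
      rcases le_total 0 x with h | h
      · exact ⟨1, by norm_num, abs_le.2 ⟨by linarith, by linarith⟩⟩
      · exact ⟨-1, by norm_num, abs_le.2 ⟨by linarith, by linarith⟩⟩
    obtain ⟨s, hs, hsum⟩ := ih hxe
    refine ⟨Fin.cons e s, Fin.cases (by simpa using he) (by simpa using hs), ?_⟩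
    have h : x - ∑ l, ((2 : ℝ) ^ (l.val + 1))⁻¹ * (Fin.cons e s : Fin (k + 1) → ℝ) l =
        2⁻¹ * (2 * x - e - ∑ l, ((2 : ℝ) ^ (l.val + 1))⁻¹ * s l) := by
      rw [Fin.sum_univ_succ, mul_sub, Finset.mul_sum]
      simp only [Fin.cons_zero, Fin.cons_succ, Fin.val_zero, Fin.val_succ, pow_succ _ (_ + 1),
        _root_.mul_inv_rev, mul_assoc]
      ring
    rw [h, abs_mul, abs_of_pos (by norm_num), pow_succ, _root_.mul_inv_rev]
    gcongr

/-- Any Hermitian `O` with `‖O‖∞ ≤ 1` decomposes as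
`O = Σ_{l=1}^{k} 2^{-l} O_l + O_Δ` with each `O_l` dichotomic and `‖O_Δ‖∞ ≤ 2^{-k}`. -/
theorem dichotomic_decomposition_general {d : ℕ} (O : Matrix (Fin d) (Fin d) ℂ)
    (hO : O.IsHermitian) (hOnorm : l2OpNorm O ≤ 1) (k : ℕ) (hk : 1 ≤ k) :
    ∃ (Os : Fin k → Matrix (Fin d) (Fin d) ℂ) (OΔ : Matrix (Fin d) (Fin d) ℂ),
      (∀ l, (Os l).IsHermitian ∧ Os l * Os l = 1) ∧
      OΔ.IsHermitian ∧ l2OpNorm OΔ ≤ ((2 : ℝ) ^ k)⁻¹ ∧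
      O = (∑ l : Fin k, ((2 : ℂ) ^ (l.val + 1))⁻¹ • Os l) + OΔ := by
  have hspec : O = Unitary.conjStarAlgAut ℂ _ hO.eigenvectorUnitary
      (diagonal fun i => (hO.eigenvalues i : ℂ)) := hO.spectral_theorem
  have heig (i : Fin d) : |hO.eigenvalues i| ≤ 1 := by
    rw [hspec, l2OpNorm_conjStarAlgAut_diagonal] at hOnorm
    exact (norm_le_pi_norm hO.eigenvalues i).trans hOnorm
  choose s hs hsum using fun i => exists_signed_binary_expansion k (heig i)
  set φ := Unitary.conjStarAlgAut ℂ _ hO.eigenvectorUnitary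
  let r (i : Fin d) : ℝ := hO.eigenvalues i - ∑ l, ((2 : ℝ) ^ (l.val + 1))⁻¹ * s i l
  refine ⟨fun l => φ (diagonal fun i => (s i l : ℂ)), φ (diagonal fun i => (r i : ℂ)),
    fun l => ⟨isHermitian_conjStarAlgAut_diagonal _ _, ?_⟩,
    isHermitian_conjStarAlgAut_diagonal _ _, ?_, ?_⟩
  · rw [← map_mul, diagonal_mul_diagonal]
    simp [← Complex.ofReal_mul, hs]
  · rw [l2OpNorm_conjStarAlgAut_diagonal]
    exact (pi_norm_le_iff_of_nonneg (by positivity)).2 hsum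
  · refine hspec.trans ?_
    simp only [← map_smul, ← map_sum, ← map_add]
    congr 1
    ext i j
    rcases eq_or_ne i j with rfl | hij
    · simp [Matrix.sum_apply, r]
    · simp [Matrix.sum_apply, hij]
end

section
/- Let n ≥ 1, d = 2ⁿ, and let ρ be a d×d density matrix (indexed by Fin n → Fin 2). Let Q = 4^{−n} Σ_v (P_v)^{⊗4}, where the sum runs over all 4ⁿ Pauli strings P_v. Then for every permutation σ of {1,2,3,4}, the number Tr(P_σ Q ρ^{⊗4}) is real and satisfies Tr(P_σ Q ρ^{⊗4}) ≤ 1/2ⁿ, where P_σ is the permutation operator on the 4-fold tensor power. -/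
open Matrix ComplexOrder

/-- The four single-qubit Pauli matrices `I, X, Y, Z`. -/
noncomputable def pauliMat : Fin 4 → Matrix (Fin 2) (Fin 2) ℂ
  | 0 => 1
  | 1 => !![0, 1; 1, 0]
  | 2 => !![0, -Complex.I; Complex.I, 0]
  | 3 => !![1, 0; 0, -1]

/-- The Pauli string `P_v = σ_{v 0} ⊗ ⋯ ⊗ σ_{v (n-1)}` as a `2ⁿ × 2ⁿ` matrix
indexed by functions `Fin n → Fin 2`. -/
noncomputable def pauliString {n : ℕ} (v : Fin n → Fin 4) :
    Matrix (Fin n → Fin 2) (Fin n → Fin 2) ℂ :=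
  Matrix.of fun a b => ∏ i, pauliMat (v i) (a i) (b i)

/-- The 4-fold tensor (Kronecker) power of a square matrix, indexed by 4-tuples. -/
noncomputable def tpow4 {ι : Type*} [Fintype ι] (A : Matrix ι ι ℂ) :
    Matrix (Fin 4 → ι) (Fin 4 → ι) ℂ :=
  Matrix.of fun a b => ∏ k, A (a k) (b k)

/-- The permutation operator `P_σ` on the 4-fold tensor power:
`(P_σ)_{a,b} = 1` if `a (σ k) = b k` for all `k`, else `0`. -/
noncomputable def permOp4 {ι : Type*} [DecidableEq ι] (σ : Equiv.Perm (Fin 4)) :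
    Matrix (Fin 4 → ι) (Fin 4 → ι) ℂ :=
  Matrix.of fun a b => if ∀ k, a (σ k) = b k then 1 else 0

/-- The projector `Q = 4^{−n} Σ_v (P_v)^{⊗4}` onto the span of 4-fold Pauli tensor powers. -/
noncomputable def pauliQ (n : ℕ) :
    Matrix (Fin 4 → (Fin n → Fin 2)) (Fin 4 → (Fin n → Fin 2)) ℂ :=
  ((4 : ℂ) ^ n)⁻¹ • ∑ v : Fin n → Fin 4, tpow4 (pauliString v)

section Frobenius

open scoped Matrix.Norms.Frobenius

variable {m ι : Type*} [Fintype m] [Fintype ι]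

theorem frobenius_norm_sq (A : Matrix m ι ℂ) : ‖A‖ ^ 2 = ∑ i, ∑ j, ‖A i j‖ ^ 2 := by
  rw [frobenius_norm_def, ← Real.sqrt_eq_rpow, Real.sq_sqrt (by positivity)]
  simp

theorem trace_conjTranspose_mul_self_eq_frobenius (A : Matrix m ι ℂ) :
    trace (Aᴴ * A) = ((‖A‖ ^ 2 : ℝ) : ℂ) := by
  rw [frobenius_norm_sq, Finset.sum_comm]
  simp [trace, mul_apply, Complex.conj_mul']

theorem norm_trace_mul_le_frobenius (A : Matrix m ι ℂ) (B : Matrix ι m ℂ) :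
    ‖trace (A * B)‖ ≤ ‖A‖ * ‖B‖ := by
  have hA : ‖A‖ = √(∑ p : m × ι, ‖A p.1 p.2‖ ^ 2) := by
    rw [Fintype.sum_prod_type]
    exact (frobenius_norm_sq A ▸ Real.sqrt_sq (norm_nonneg A)).symm
  have hB : ‖B‖ = √(∑ p : m × ι, ‖B p.2 p.1‖ ^ 2) := by
    rw [Fintype.sum_prod_type_right]
    exact (frobenius_norm_sq B ▸ Real.sqrt_sq (norm_nonneg B)).symm
  calc ‖trace (A * B)‖ = ‖∑ p : m × ι, A p.1 p.2 * B p.2 p.1‖ := by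
        simp [trace, mul_apply, Fintype.sum_prod_type]
    _ ≤ ∑ p : m × ι, ‖A p.1 p.2‖ * ‖B p.2 p.1‖ :=
        (norm_sum_le _ _).trans_eq (by simp)
    _ ≤ ‖A‖ * ‖B‖ := by rw [hA, hB]; exact Real.sum_mul_le_sqrt_mul_sqrt _ _ _

theorem frobenius_norm_mul_involution [DecidableEq ι] (S : Matrix m ι ℂ) {P : Matrix ι ι ℂ}
    (hP : P.IsHermitian) (hPP : P * P = 1) : ‖S * P‖ = ‖S‖ := by
  have h : ((‖S * P‖ ^ 2 : ℝ) : ℂ) = ((‖S‖ ^ 2 : ℝ) : ℂ) := by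
    rw [← trace_conjTranspose_mul_self_eq_frobenius, ← trace_conjTranspose_mul_self_eq_frobenius,
      conjTranspose_mul, hP.eq, Matrix.mul_assoc, trace_mul_comm, Matrix.mul_assoc, Matrix.mul_assoc,
      hPP, Matrix.mul_one]
  exact (pow_left_inj₀ (norm_nonneg _) (norm_nonneg _) two_ne_zero).1 (Complex.ofReal_injective h)

end Frobenius

section Moments

variable {ι : Type*} [Fintype ι] [DecidableEq ι]

theorem Matrix.IsHermitian.trace_pow_im {M : Matrix ι ι ℂ} (hM : M.IsHermitian) (k : ℕ) :
    (trace (M ^ k)).im = 0 := by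
  have h := trace_conjTranspose (M ^ k)
  rw [conjTranspose_pow, hM.eq] at h
  exact Complex.conj_eq_iff_im.1 h.symm

open scoped Matrix.Norms.Frobenius MatrixOrder in
/-- The power traces `t k = Tr ((P ρ) ^ k)` for a Hermitian involution `P` and a density matrix
`ρ` are real, `t 1` and `t 2` are bounded by one, and `t 3`, `t 4` are bounded by `t 2`. -/
theorem exists_trace_pow_bounds {P ρ : Matrix ι ι ℂ} (hP : P.IsHermitian) (hPP : P * P = 1)
    (hρ : ρ.PosSemidef) (hρtr : ρ.trace = 1) :
    ∃ t : ℕ → ℝ, (∀ k, trace ((P * ρ) ^ (k + 1)) = (t (k + 1) : ℂ)) ∧ |t 1| ≤ 1 ∧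
      0 ≤ t 2 ∧ t 2 ≤ 1 ∧ |t 3| ≤ t 2 ∧ t 4 ≤ t 2 := by
  obtain ⟨S, rfl⟩ : ∃ S : Matrix ι ι ℂ, ρ = Sᴴ * S := by
    obtain ⟨S, hS⟩ := CStarAlgebra.nonneg_iff_eq_star_mul_self.mp hρ.nonneg
    exact ⟨S, hS⟩
  set M := S * P * Sᴴ with hMdef
  have hM : M.IsHermitian := by
    simp [Matrix.IsHermitian, hMdef, hP.eq, Matrix.mul_assoc]
  have hpow (k : ℕ) : S * (P * (Sᴴ * S)) ^ k = M ^ k * S := by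
    induction k with
    | zero => simp
    | succ k ih =>
      rw [pow_succ, ← Matrix.mul_assoc, ih, pow_succ]
      simp only [hMdef, Matrix.mul_assoc]
  have htr (k : ℕ) : trace ((P * (Sᴴ * S)) ^ (k + 1)) = trace (M ^ (k + 1)) := by
    rw [pow_succ', show P * (Sᴴ * S) * (P * (Sᴴ * S)) ^ k = P * Sᴴ * (S * (P * (Sᴴ * S)) ^ k) by
        simp only [Matrix.mul_assoc], hpow, trace_mul_comm, pow_succ,
      Matrix.mul_assoc, ← Matrix.mul_assoc S]
  have hS : ‖S‖ ^ 2 = 1 := by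
    rw [trace_conjTranspose_mul_self_eq_frobenius] at hρtr
    exact_mod_cast hρtr
  have hS' : ‖S‖ = 1 := by nlinarith [norm_nonneg S]
  have hSP := frobenius_norm_mul_involution S hP hPP
  have hM1 : ‖M‖ ≤ 1 := by
    have := frobenius_norm_mul (S * P) Sᴴ
    rwa [hSP, frobenius_norm_conjTranspose, hS', one_mul] at this
  have hMM : ‖M ^ 2‖ ≤ ‖M‖ ^ 2 := by
    rw [sq, sq]; exact frobenius_norm_mul M M
  have ht2 : (trace (M ^ 2)).re = ‖M‖ ^ 2 := by
    have := trace_conjTranspose_mul_self_eq_frobenius M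
    rw [hM.eq, ← sq] at this
    rw [this, Complex.ofReal_re]
  have hM0 := norm_nonneg M
  refine ⟨fun k => (trace (M ^ k)).re, fun k => ?_, ?_, ?_, ?_, ?_, ?_⟩
  · rw [htr]
    exact Complex.ext (by simp) (by simp [hM.trace_pow_im])
  · refine (Complex.abs_re_le_norm _).trans ?_
    have := norm_trace_mul_le_frobenius (S * P) Sᴴ
    rwa [hSP, frobenius_norm_conjTranspose, hS', one_mul, ← hMdef, ← pow_one M] at this
  · simp only [ht2]; positivity
  · simp only [ht2]; nlinarith
  · simp only [ht2]
    refine (Complex.abs_re_le_norm _).trans ?_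
    have := norm_trace_mul_le_frobenius M (M ^ 2)
    rw [← pow_succ'] at this
    nlinarith [norm_nonneg (M ^ 2)]
  · simp only [ht2]
    refine (Complex.re_le_norm _).trans ?_
    have := norm_trace_mul_le_frobenius (M ^ 2) (M ^ 2)
    rw [← pow_add] at this
    nlinarith [norm_nonneg (M ^ 2), pow_le_one₀ (n := 2) hM0 hM1]

theorem Matrix.PosSemidef.trace_sq_re_le_one {ρ : Matrix ι ι ℂ} (hρ : ρ.PosSemidef)
    (hρtr : ρ.trace = 1) : (trace (ρ * ρ)).re ≤ 1 := by
  obtain ⟨t, ht, -, -, h, -⟩ := exists_trace_pow_bounds isHermitian_one (one_mul 1) hρ hρtr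
  have := ht 1
  rw [one_mul, one_add_one_eq_two, sq] at this
  rwa [this, Complex.ofReal_re]

end Moments

section CycleTraces

variable {ι : Type*} [Fintype ι]

theorem sum_fin_four_arrow (f : (Fin 4 → ι) → ℂ) :
    ∑ a, f a = ∑ a, ∑ b, ∑ c, ∑ d, f ![a, b, c, d] := by
  simp only [← (Fin.consEquiv fun _ => ι).sum_comp, Fintype.sum_prod_type, Fin.consEquiv,
    Equiv.coe_fn_mk, Fintype.sum_unique]
  rfl

/-- `Tr (P_σ A^{⊗4})` written out as a sum over indices. -/
noncomputable def permTrace (σ : Equiv.Perm (Fin 4)) (A : Matrix ι ι ℂ) : ℂ :=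
  ∑ a : Fin 4 → ι, ∏ k, A (a (σ k)) (a k)

theorem permTrace_conj (σ τ : Equiv.Perm (Fin 4)) (A : Matrix ι ι ℂ) :
    permTrace (τ * σ * τ⁻¹) A = permTrace σ A := by
  unfold permTrace
  rw [← (Equiv.arrowCongr τ (Equiv.refl ι)).sum_comp]
  refine Finset.sum_congr rfl fun a _ => ?_
  rw [← Equiv.prod_comp τ]
  simp

theorem sum_congr_four {f g : ι → ι → ι → ι → ℂ} (h : ∀ a b c d, f a b c d = g a b c d) :
    ∑ a, ∑ b, ∑ c, ∑ d, f a b c d = ∑ a, ∑ b, ∑ c, ∑ d, g a b c d := by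
  simp only [h]

theorem permTrace_eq_sum (σ : Equiv.Perm (Fin 4)) (A : Matrix ι ι ℂ) :
    permTrace σ A = ∑ a, ∑ b, ∑ c, ∑ d, A (![a, b, c, d] (σ 0)) a * A (![a, b, c, d] (σ 1)) b *
      A (![a, b, c, d] (σ 2)) c * A (![a, b, c, d] (σ 3)) d := by
  rw [permTrace, sum_fin_four_arrow]
  simp only [Fin.prod_univ_four]
  rfl

set_option maxRecDepth 4000 in
/-- Representatives of the conjugacy classes of `S₄`. -/
theorem exists_conj_rep (σ : Equiv.Perm (Fin 4)) : ∃ τ π : Equiv.Perm (Fin 4), σ = τ * π * τ⁻¹ ∧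
    (π = 1 ∨ π = Equiv.swap 2 3 ∨ π = Equiv.swap 0 1 * Equiv.swap 2 3 ∨
      π = Equiv.swap 1 2 * Equiv.swap 2 3 ∨
      π = Equiv.swap 0 1 * Equiv.swap 1 2 * Equiv.swap 2 3) := by
  revert σ; decide

theorem permTrace_cases [DecidableEq ι] (σ : Equiv.Perm (Fin 4)) :
    (∀ A : Matrix ι ι ℂ, permTrace σ A = trace A ^ 4) ∨
    (∀ A : Matrix ι ι ℂ, permTrace σ A = trace (A ^ 2) * trace A ^ 2) ∨
    (∀ A : Matrix ι ι ℂ, permTrace σ A = trace (A ^ 2) ^ 2) ∨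
    (∀ A : Matrix ι ι ℂ, permTrace σ A = trace (A ^ 3) * trace A) ∨
    (∀ A : Matrix ι ι ℂ, permTrace σ A = trace (A ^ 4)) := by
  obtain ⟨τ, π, rfl, rfl | rfl | rfl | rfl | rfl⟩ := exists_conj_rep σ
  all_goals simp only [permTrace_conj]
  · refine Or.inl <| fun A => ?_
    trans ∑ a, ∑ b, ∑ c, ∑ d, A a a * A b b * A c c * A d d
    · exact permTrace_eq_sum _ A
    · simp only [pow_succ, pow_zero, one_mul, trace, diag, Finset.sum_mul, Finset.mul_sum]
      exact sum_congr_four fun a b c d => by ring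
  · refine Or.inr <| Or.inl <| fun A => ?_
    trans ∑ a, ∑ b, ∑ c, ∑ d, A a a * A b b * A d c * A c d
    · exact permTrace_eq_sum _ A
    · simp only [pow_succ, pow_zero, one_mul, trace, diag, mul_apply, Finset.sum_mul,
        Finset.mul_sum]
      exact sum_congr_four fun a b c d => by ring
  · refine Or.inr <| Or.inr <| Or.inl <| fun A => ?_
    trans ∑ a, ∑ b, ∑ c, ∑ d, A b a * A a b * A d c * A c d
    · exact permTrace_eq_sum _ A
    · simp only [pow_succ, pow_zero, one_mul, trace, diag, mul_apply, Finset.sum_mul,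
        Finset.mul_sum]
      exact sum_congr_four fun a b c d => by ring
  · refine Or.inr <| Or.inr <| Or.inr <| Or.inl <| fun A => ?_
    trans ∑ a, ∑ b, ∑ c, ∑ d, A a a * A c b * A d c * A b d
    · exact permTrace_eq_sum _ A
    · simp only [pow_succ, pow_zero, one_mul, trace, diag, mul_apply, Finset.sum_mul,
        Finset.mul_sum]
      exact sum_congr_four fun a b c d => by ring
  · refine Or.inr <| Or.inr <| Or.inr <| Or.inr <| fun A => ?_
    trans ∑ a, ∑ b, ∑ c, ∑ d, A b a * A c b * A d c * A a d
    · exact permTrace_eq_sum _ A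
    · simp only [pow_succ, pow_zero, one_mul, trace, diag, mul_apply, Finset.sum_mul]
      exact sum_congr_four fun a b c d => by ring

theorem tpow4_mul (A B : Matrix ι ι ℂ) : tpow4 A * tpow4 B = tpow4 (A * B) := by
  ext a b
  simp only [tpow4, mul_apply, of_apply, Fintype.prod_sum, Finset.prod_mul_distrib]

theorem trace_permOp4_mul_tpow4 [DecidableEq ι] (σ : Equiv.Perm (Fin 4)) (A : Matrix ι ι ℂ) :
    trace (permOp4 σ * tpow4 A) = permTrace σ A := by
  unfold permTrace
  simp only [trace, diag, mul_apply, permOp4, tpow4, of_apply]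
  refine Finset.sum_congr rfl fun a _ => ?_
  rw [Finset.sum_eq_single (fun k => a (σ k))]
  · simp
  · intro b _ hb
    rw [if_neg fun h => hb (funext fun k => (h k).symm), zero_mul]
  · simp

end CycleTraces

section Pauli

theorem pauliMat_isHermitian (k : Fin 4) : (pauliMat k).IsHermitian := by
  ext a b
  fin_cases k <;> fin_cases a <;> fin_cases b <;> simp [pauliMat]

theorem pauliMat_mul_self (k : Fin 4) : pauliMat k * pauliMat k = 1 := by
  ext a b
  fin_cases k <;> fin_cases a <;> fin_cases b <;> simp [pauliMat, mul_apply]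

theorem sum_pauliMat_mul (a b c d : Fin 2) :
    ∑ k, pauliMat k a b * pauliMat k c d = if a = d ∧ b = c then 2 else 0 := by
  fin_cases a <;> fin_cases b <;> fin_cases c <;> fin_cases d <;>
    norm_num [pauliMat, Fin.sum_univ_four]

variable {n : ℕ}

theorem pauliString_isHermitian (v : Fin n → Fin 4) : (pauliString v).IsHermitian := by
  ext a b
  simp only [conjTranspose_apply, pauliString, of_apply, star_prod]
  exact Finset.prod_congr rfl fun i _ => (pauliMat_isHermitian (v i)).apply _ _

theorem pauliString_mul_self (v : Fin n → Fin 4) : pauliString v * pauliString v = 1 := by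
  ext a b
  simp only [mul_apply, pauliString, of_apply, ← Finset.prod_mul_distrib]
  rw [← Fintype.prod_sum (fun i c => pauliMat (v i) (a i) c * pauliMat (v i) c (b i))]
  simp only [← mul_apply, pauliMat_mul_self, one_apply, Finset.prod_ite_zero, funext_iff]
  simp

theorem sum_pauliString_mul (a b c d : Fin n → Fin 2) :
    ∑ v, pauliString v a b * pauliString v c d = if a = d ∧ b = c then 2 ^ n else 0 := by
  simp only [pauliString, of_apply, ← Finset.prod_mul_distrib]
  rw [← Fintype.prod_sum (fun i k => pauliMat k (a i) (b i) * pauliMat k (c i) (d i))]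
  simp only [sum_pauliMat_mul, Finset.prod_ite_zero, funext_iff, forall_and]
  simp

theorem sum_sum_pauliString_mul (f : (a b c d : Fin n → Fin 2) → ℂ) :
    ∑ v, ∑ a, ∑ b, ∑ c, ∑ d, f a b c d * (pauliString v a b * pauliString v c d) =
      2 ^ n * ∑ a, ∑ b, f a b b a := by
  rw [Finset.sum_comm, Finset.mul_sum]
  refine Finset.sum_congr rfl fun a _ => ?_
  rw [Finset.sum_comm, Finset.mul_sum]
  refine Finset.sum_congr rfl fun b _ => ?_
  rw [Finset.sum_comm, Finset.sum_eq_single b]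
  · rw [Finset.sum_comm, Finset.sum_eq_single a]
    · simp [← Finset.mul_sum, sum_pauliString_mul, mul_comm]
    · intro d _ hd
      simp [← Finset.mul_sum, sum_pauliString_mul, hd.symm]
    · simp
  · intro c _ hc
    rw [Finset.sum_comm]
    simp [← Finset.mul_sum, sum_pauliString_mul, hc.symm]
  · simp

theorem sum_trace_pauliString_mul_sq (ρ : Matrix (Fin n → Fin 2) (Fin n → Fin 2) ℂ) :
    ∑ v, trace (pauliString v * ρ) ^ 2 = 2 ^ n * trace (ρ * ρ) := by
  have h (v : Fin n → Fin 4) : trace (pauliString v * ρ) ^ 2 =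
      ∑ a, ∑ b, ∑ c, ∑ d, ρ b a * ρ d c * (pauliString v a b * pauliString v c d) := by
    simp only [sq, trace, diag, mul_apply, Finset.sum_mul_sum]
    refine Finset.sum_congr rfl fun a _ => ?_
    rw [Finset.sum_comm]
    refine Finset.sum_congr rfl fun b _ => Finset.sum_congr rfl fun c _ =>
      Finset.sum_congr rfl fun d _ => by ring
  simp only [h, sum_sum_pauliString_mul (fun a b c d => ρ b a * ρ d c)]
  simp [trace, mul_apply, mul_comm]

theorem sum_trace_pauliString_mul_pow_two (ρ : Matrix (Fin n → Fin 2) (Fin n → Fin 2) ℂ) :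
    ∑ v, trace ((pauliString v * ρ) ^ 2) = 2 ^ n * trace ρ ^ 2 := by
  have h (v : Fin n → Fin 4) : trace ((pauliString v * ρ) ^ 2) =
      ∑ a, ∑ b, ∑ c, ∑ d, ρ b c * ρ d a * (pauliString v a b * pauliString v c d) := by
    simp only [sq, trace, diag, mul_apply, Finset.sum_mul_sum]
    refine Finset.sum_congr rfl fun a _ => ?_
    rw [Finset.sum_comm]
    refine Finset.sum_congr rfl fun b _ => Finset.sum_congr rfl fun c _ =>
      Finset.sum_congr rfl fun d _ => by ring
  simp only [h, sum_sum_pauliString_mul (fun a b c d => ρ b c * ρ d a)]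
  simp [trace, sq, Finset.sum_mul_sum, mul_comm]

end Pauli

/-- For any `n`-qubit density matrix `ρ` and any permutation `σ ∈ S₄`,
`Tr(P_σ Q ρ^{⊗4})` is real and at most `1/2ⁿ`. -/
theorem trace_permOp_pauliQ_le {n : ℕ} (hn : 1 ≤ n)
    (ρ : Matrix (Fin n → Fin 2) (Fin n → Fin 2) ℂ)
    (hρ : ρ.PosSemidef) (hρtr : ρ.trace = 1) (σ : Equiv.Perm (Fin 4)) :
    (trace (permOp4 σ * pauliQ n * tpow4 ρ)).im = 0 ∧
      (trace (permOp4 σ * pauliQ n * tpow4 ρ)).re ≤ 1 / 2 ^ n := by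
  set p : (Fin n → Fin 4) → ℂ := fun v => permTrace σ (pauliString v * ρ) with hp
  have hsum : trace (permOp4 σ * pauliQ n * tpow4 ρ) = ((4 : ℂ) ^ n)⁻¹ * ∑ v, p v := by
    simp only [pauliQ, hp, Matrix.mul_assoc, Matrix.smul_mul, Matrix.mul_smul, Matrix.sum_mul,
      Matrix.mul_sum, tpow4_mul, trace_smul, trace_sum, trace_permOp4_mul_tpow4, smul_eq_mul]
  choose t ht h1 h2 h2' h3 h4 using fun v : Fin n → Fin 4 =>
    exists_trace_pow_bounds (pauliString_isHermitian v) (pauliString_mul_self v) hρ hρtr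
  have ht1 (v : Fin n → Fin 4) : trace (pauliString v * ρ) = (t v 1 : ℂ) := by
    simpa using ht v 0
  have ht2 (v : Fin n → Fin 4) : trace ((pauliString v * ρ) ^ 2) = (t v 2 : ℂ) := ht v 1
  have ht3 (v : Fin n → Fin 4) : trace ((pauliString v * ρ) ^ 3) = (t v 3 : ℂ) := ht v 2
  have ht4 (v : Fin n → Fin 4) : trace ((pauliString v * ρ) ^ 4) = (t v 4 : ℂ) := ht v 3
  have hsq (v : Fin n → Fin 4) : t v 1 ^ 2 ≤ 1 := (sq_le_one_iff_abs_le_one _).2 (h1 v)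
  have hsum1 : ∑ v, t v 1 ^ 2 ≤ (2 : ℝ) ^ n := by
    have h : ((∑ v, t v 1 ^ 2 : ℝ) : ℂ) = ((2 ^ n : ℝ) : ℂ) * trace (ρ * ρ) := by
      simpa [ht1] using sum_trace_pauliString_mul_sq ρ
    have h' := congrArg Complex.re h
    rw [Complex.ofReal_re, Complex.re_ofReal_mul] at h'
    rw [h']
    exact mul_le_of_le_one_right (by positivity) (hρ.trace_sq_re_le_one hρtr)
  have hsum2 : ∑ v, t v 2 ≤ (2 : ℝ) ^ n := by
    have h := sum_trace_pauliString_mul_pow_two ρ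
    simp only [ht2, hρtr, one_pow, mul_one] at h
    exact le_of_eq (by exact_mod_cast h)
  obtain ⟨q, hq, hqle⟩ : ∃ q : (Fin n → Fin 4) → ℝ,
      (∀ v, p v = (q v : ℂ)) ∧ ∑ v, q v ≤ (2 : ℝ) ^ n := by
    rcases permTrace_cases (ι := Fin n → Fin 2) σ with h | h | h | h | h
    · refine ⟨fun v => t v 1 ^ 4, fun v => by simp [hp, h, ht1],
        (Finset.sum_le_sum fun v _ => ?_).trans hsum1⟩
      nlinarith [hsq v, sq_nonneg (t v 1)]
    · refine ⟨fun v => t v 2 * t v 1 ^ 2, fun v => by simp [hp, h, ht1, ht2],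
        (Finset.sum_le_sum fun v _ => ?_).trans hsum2⟩
      exact mul_le_of_le_one_right (h2 v) (hsq v)
    · refine ⟨fun v => t v 2 ^ 2, fun v => by simp [hp, h, ht2],
        (Finset.sum_le_sum fun v _ => ?_).trans hsum2⟩
      exact pow_le_of_le_one (h2 v) (h2' v) two_ne_zero
    · refine ⟨fun v => t v 3 * t v 1, fun v => by simp [hp, h, ht1, ht3],
        (Finset.sum_le_sum fun v _ => ?_).trans hsum2⟩
      calc t v 3 * t v 1 ≤ |t v 3| * |t v 1| := (le_abs_self _).trans_eq (abs_mul _ _)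
        _ ≤ |t v 3| := mul_le_of_le_one_right (abs_nonneg _) (h1 v)
        _ ≤ t v 2 := h3 v
    · exact ⟨fun v => t v 4, fun v => by simp [hp, h, ht4],
        (Finset.sum_le_sum fun v _ => h4 v).trans hsum2⟩
  have hreal : trace (permOp4 σ * pauliQ n * tpow4 ρ) = ((((4 : ℝ) ^ n)⁻¹ * ∑ v, q v : ℝ) : ℂ) := by
    rw [hsum]
    simp [hq]
  rw [hreal]
  refine ⟨Complex.ofReal_im _, ?_⟩
  rw [Complex.ofReal_re]
  calc ((4 : ℝ) ^ n)⁻¹ * ∑ v, q v ≤ ((4 : ℝ) ^ n)⁻¹ * 2 ^ n := by gcongr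
    _ = 1 / 2 ^ n := by
      rw [show (4 : ℝ) = 2 * 2 by norm_num, mul_pow]
      field_simp
end

section
/- Let d ≥ 1 and let μ be the Haar probability measure on the compact group U(d) of d×d complex unitary matrices. Let X₂ be the diagonal matrix indexed by Fin d × Fin d whose diagonal entry at (s,t) equals d if s = t and −1 otherwise. Let S be the swap operator, the matrix indexed by Fin d × Fin d with entries S_{(a,b),(c,e)} = 1 if a = e and b = c, and 0 otherwise. Then ∫ (U ⊗ U)† X₂ (U ⊗ U) dμ(U) = S, where U ⊗ U denotes the Kronecker product regarded as a matrix indexed by Fin d × Fin d. -/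
open MeasureTheory Matrix Kronecker

noncomputable instance {d : ℕ} : MeasurableSpace (Matrix (Fin d) (Fin d) ℂ) := borel _
instance {d : ℕ} : BorelSpace (Matrix (Fin d) (Fin d) ℂ) := ⟨rfl⟩

namespace UnitaryTwirl

open ComplexConjugate

variable {d : ℕ}

instance compactSpace_unitaryGroup : CompactSpace (unitaryGroup (Fin d) ℂ) := by
  refine isCompact_iff_compactSpace.mp (?_ : IsCompact
    (unitaryGroup (Fin d) ℂ : Set (Matrix (Fin d) (Fin d) ℂ)))
  have hball : IsCompact ({A | ∀ i j, A i j ∈ Metric.closedBall (0 : ℂ) 1} :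
      Set (Matrix (Fin d) (Fin d) ℂ)) :=
    isCompact_pi_infinite fun _ => isCompact_pi_infinite fun _ => isCompact_closedBall _ _
  refine hball.of_isClosed_subset ?_ fun U hU i j => by
    simpa using entry_norm_bound_of_unitary hU i j
  have hset : (unitaryGroup (Fin d) ℂ : Set (Matrix (Fin d) (Fin d) ℂ)) =
      {A | A * star A = 1} := Set.ext fun A => mem_unitaryGroup_iff
  rw [hset]
  exact isClosed_eq (by fun_prop) continuous_const

instance isMulRightInvariant_haar (μ : Measure (unitaryGroup (Fin d) ℂ))
    [μ.IsHaarMeasure] [IsProbabilityMeasure μ] : μ.IsMulRightInvariant where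
  map_mul_right_eq_self g := by
    have : IsProbabilityMeasure (μ.map (· * g)) :=
      Measure.isProbabilityMeasure_map (measurable_mul_const g).aemeasurable
    have : (μ.map (· * g)).IsHaarMeasure := Measure.isHaarMeasure_map_mul_right μ g
    exact Measure.isHaarMeasure_eq_of_isProbabilityMeasure _ _

/-- The sum over rows `s` of `conj (U x)ₛ * conj (U y)ₛ * (U z)ₛ * (U w)ₛ`. -/
noncomputable def rowQuartic (x y z w : Fin d → ℂ) (U : unitaryGroup (Fin d) ℂ) : ℂ :=
  ∑ s, conj ((U.1 *ᵥ x) s) * conj ((U.1 *ᵥ y) s) * (U.1 *ᵥ z) s * (U.1 *ᵥ w) s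

/-- The Haar average of `rowQuartic`. -/
noncomputable def moment (μ : Measure (unitaryGroup (Fin d) ℂ)) (x y z w : Fin d → ℂ) : ℂ :=
  ∫ U, rowQuartic x y z w U ∂μ

lemma continuous_rowQuartic (x y z w : Fin d → ℂ) : Continuous (rowQuartic x y z w) := by
  unfold rowQuartic
  have h (x : Fin d → ℂ) (s : Fin d) :
      Continuous fun U : unitaryGroup (Fin d) ℂ => (U.1 *ᵥ x) s :=
    (continuous_apply s).comp (continuous_subtype_val.matrix_mulVec continuous_const)
  have hc (x : Fin d → ℂ) (s : Fin d) :
      Continuous fun U : unitaryGroup (Fin d) ℂ => conj ((U.1 *ᵥ x) s) :=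
    Complex.continuous_conj.comp (h x s)
  exact continuous_finsetSum _ fun s _ => (((hc x s).mul (hc y s)).mul (h z s)).mul (h w s)

lemma integrable_of_continuous (μ : Measure (unitaryGroup (Fin d) ℂ)) [IsProbabilityMeasure μ]
    {f : unitaryGroup (Fin d) ℂ → ℂ} (hf : Continuous f) : Integrable f μ :=
  hf.integrable_of_hasCompactSupport (HasCompactSupport.of_compactSpace f)

lemma moment_swap_left (μ : Measure (unitaryGroup (Fin d) ℂ)) (x y z w : Fin d → ℂ) :
    moment μ x y z w = moment μ y x z w := by
  simp only [moment, rowQuartic, mul_comm (conj ((_ *ᵥ x) _)) (conj ((_ *ᵥ y) _))]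

lemma moment_swap_right (μ : Measure (unitaryGroup (Fin d) ℂ)) (x y z w : Fin d → ℂ) :
    moment μ x y z w = moment μ x y w z := by
  simp only [moment, rowQuartic, mul_right_comm _ ((_ *ᵥ z) _) ((_ *ᵥ w) _)]

section Moment

variable (μ : Measure (unitaryGroup (Fin d) ℂ)) [IsProbabilityMeasure μ]

lemma integrable_rowQuartic (x y z w : Fin d → ℂ) : Integrable (rowQuartic x y z w) μ :=
  integrable_of_continuous μ (continuous_rowQuartic x y z w)

lemma moment_comb₄ (x y z w w' : Fin d → ℂ) (α β : ℂ) :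
    moment μ x y z (α • w + β • w') = α * moment μ x y z w + β * moment μ x y z w' := by
  simp only [moment]
  rw [← integral_const_mul, ← integral_const_mul, ← integral_add
    ((integrable_rowQuartic μ x y z w).const_mul α)
    ((integrable_rowQuartic μ x y z w').const_mul β)]
  refine integral_congr_ae (.of_forall fun U => ?_)
  simp only [rowQuartic, mulVec_add, mulVec_smul, Pi.add_apply, Pi.smul_apply, smul_eq_mul,
    Finset.mul_sum, ← Finset.sum_add_distrib]
  exact Finset.sum_congr rfl fun s _ => by ring

lemma moment_comb₃ (x y z z' w : Fin d → ℂ) (α β : ℂ) :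
    moment μ x y (α • z + β • z') w = α * moment μ x y z w + β * moment μ x y z' w := by
  simp only [moment_swap_right μ x y _ w, moment_comb₄]

lemma moment_comb₂ (x y y' z w : Fin d → ℂ) (α β : ℂ) :
    moment μ x (α • y + β • y') z w =
      conj α * moment μ x y z w + conj β * moment μ x y' z w := by
  simp only [moment]
  rw [← integral_const_mul, ← integral_const_mul, ← integral_add
    ((integrable_rowQuartic μ x y z w).const_mul _)
    ((integrable_rowQuartic μ x y' z w).const_mul _)]
  refine integral_congr_ae (.of_forall fun U => ?_)
  simp only [rowQuartic, mulVec_add, mulVec_smul, Pi.add_apply, Pi.smul_apply, smul_eq_mul,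
    Finset.mul_sum, ← Finset.sum_add_distrib, map_add, map_mul]
  exact Finset.sum_congr rfl fun s _ => by ring

lemma moment_comb₁ (x x' y z w : Fin d → ℂ) (α β : ℂ) :
    moment μ (α • x + β • x') y z w =
      conj α * moment μ x y z w + conj β * moment μ x' y z w := by
  simp only [moment_swap_left μ _ y, moment_comb₂]

lemma moment_smul (x y z w : Fin d → ℂ) (a b c e : ℂ) :
    moment μ (a • x) (b • y) (c • z) (e • w) =
      conj a * conj b * c * e * moment μ x y z w := by
  have h (a : ℂ) (x : Fin d → ℂ) : a • x = a • x + (0 : ℂ) • x := by simp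
  rw [h a, h b, h c, h e]
  simp only [moment_comb₁, moment_comb₂, moment_comb₃, moment_comb₄, map_zero, zero_mul, add_zero]
  ring

lemma moment_mulVec [μ.IsHaarMeasure] (V : unitaryGroup (Fin d) ℂ) (x y z w : Fin d → ℂ) :
    moment μ (V.1 *ᵥ x) (V.1 *ᵥ y) (V.1 *ᵥ z) (V.1 *ᵥ w) = moment μ x y z w := by
  rw [moment, moment, ← integral_mul_right_eq_self (rowQuartic x y z w) V]
  simp [rowQuartic, mulVec_mulVec]

end Moment

/-- A rank one perturbation of the identity along a real vector is unitary when its coefficient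
satisfies the displayed quadratic equation. -/
lemma one_add_smul_vecMulVec_mem_unitaryGroup (k : ℂ) (v : Fin d → ℂ) (hv : star v = v)
    (hk : k + conj k + k * conj k * (v ⬝ᵥ v) = 0) :
    1 + k • vecMulVec v v ∈ unitaryGroup (Fin d) ℂ := by
  rw [mem_unitaryGroup_iff, star_eq_conjTranspose]
  have h : (1 + k • vecMulVec v v) * (1 + k • vecMulVec v v)ᴴ =
      1 + (k + conj k + k * conj k * (v ⬝ᵥ v)) • vecMulVec v v := by
    simp only [conjTranspose_add, conjTranspose_one, conjTranspose_smul, conjTranspose_vecMulVec,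
      hv, add_mul, mul_add, one_mul, mul_one, smul_mul_assoc, mul_smul_comm, vecMulVec_mul_vecMulVec,
      vecMulVec_smul, starRingEnd_apply]
    module
  rw [h, hk, zero_smul, add_zero]

/-- The standard basis vector. -/
abbrev basisVec (a : Fin d) : Fin d → ℂ := Pi.single a 1

lemma one_add_smul_vecMulVec_mulVec (k : ℂ) (v x : Fin d → ℂ) :
    (1 + k • vecMulVec v v) *ᵥ x = x + (k * (v ⬝ᵥ x)) • v := by
  rw [add_mulVec, one_mulVec, smul_mulVec, vecMulVec_mulVec, op_smul_eq_smul, smul_smul]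

lemma star_basisVec (a : Fin d) : star (basisVec a) = basisVec a := by
  simp [basisVec]

lemma sum_conj_mul (U : unitaryGroup (Fin d) ℂ) (a c : Fin d) :
    ∑ s, conj (U.1 s a) * U.1 s c = if a = c then 1 else 0 := by
  have h := congrFun₂ (mem_unitaryGroup_iff'.mp U.2) a c
  simpa [mul_apply, one_apply] using h

lemma sum_mul_conj (U : unitaryGroup (Fin d) ℂ) (s : Fin d) :
    ∑ b, U.1 s b * conj (U.1 s b) = 1 := by
  have h := congrFun₂ (mem_unitaryGroup_iff.mp U.2) s s
  simpa [mul_apply, one_apply] using h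

lemma rowQuartic_basisVec (U : unitaryGroup (Fin d) ℂ) (a b c e : Fin d) :
    rowQuartic (basisVec a) (basisVec b) (basisVec c) (basisVec e) U =
      ∑ s, conj (U.1 s a) * conj (U.1 s b) * U.1 s c * U.1 s e := by
  simp [rowQuartic]

lemma sum_moment_basisVec (μ : Measure (unitaryGroup (Fin d) ℂ)) [IsProbabilityMeasure μ]
    (a : Fin d) :
    ∑ b, moment μ (basisVec a) (basisVec b) (basisVec a) (basisVec b) = 1 := by
  simp only [moment]
  rw [← integral_finsetSum _ fun b _ => integrable_rowQuartic μ _ _ _ _]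
  have h (U : unitaryGroup (Fin d) ℂ) :
      ∑ b, rowQuartic (basisVec a) (basisVec b) (basisVec a) (basisVec b) U = 1 := by
    simp only [rowQuartic_basisVec]
    rw [Finset.sum_comm]
    calc _ = ∑ s, conj (U.1 s a) * U.1 s a * ∑ b, U.1 s b * conj (U.1 s b) :=
          Finset.sum_congr rfl fun s _ => by
            rw [Finset.mul_sum]; exact Finset.sum_congr rfl fun b _ => by ring
      _ = 1 := by simp only [sum_mul_conj, mul_one, sum_conj_mul, if_true]
  simp [h]

section Basis

variable (μ : Measure (unitaryGroup (Fin d) ℂ)) [μ.IsHaarMeasure] [IsProbabilityMeasure μ]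

/-- Invariance under multiplying the coordinate `x` by `I` kills unbalanced moments. -/
lemma moment_basisVec_eq_zero (x a b c e : Fin d)
    (h : conj (if a = x then Complex.I else 1) * conj (if b = x then Complex.I else 1) *
      (if c = x then Complex.I else 1) * (if e = x then Complex.I else 1) ≠ (1 : ℂ)) :
    moment μ (basisVec a) (basisVec b) (basisVec c) (basisVec e) = 0 := by
  have hV : 1 + (Complex.I - 1) • vecMulVec (basisVec x) (basisVec x) ∈
      unitaryGroup (Fin d) ℂ := by
    refine one_add_smul_vecMulVec_mem_unitaryGroup _ _ (star_basisVec x) ?_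
    simp only [single_dotProduct, Pi.single_eq_same, map_sub, Complex.conj_I, map_one]
    linear_combination -Complex.I_mul_I
  have hmul (y : Fin d) : (1 + (Complex.I - 1) • vecMulVec (basisVec x) (basisVec x)) *ᵥ
      basisVec y = (if y = x then Complex.I else 1) • basisVec y := by
    rw [one_add_smul_vecMulVec_mulVec]
    split_ifs with hy
    · subst hy
      simp only [single_dotProduct, Pi.single_eq_same]
      module
    · simp [basisVec, Pi.single_eq_of_ne hy]
  have key := moment_mulVec μ ⟨_, hV⟩ (basisVec a) (basisVec b) (basisVec c) (basisVec e)
  simp only [hmul, moment_smul] at key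
  exact (mul_left_eq_self₀.mp key).resolve_left h

lemma moment_basisVec_self {a b : Fin d} (hab : a ≠ b) :
    moment μ (basisVec a) (basisVec a) (basisVec a) (basisVec a) =
      (moment μ (basisVec a) (basisVec a) (basisVec a) (basisVec a) +
        moment μ (basisVec b) (basisVec b) (basisVec b) (basisVec b)) / 4 +
      moment μ (basisVec a) (basisVec b) (basisVec a) (basisVec b) := by
  have hV : 1 + ((Complex.I - 1) / 2) • vecMulVec (basisVec a + basisVec b)
      (basisVec a + basisVec b) ∈ unitaryGroup (Fin d) ℂ := by
    refine one_add_smul_vecMulVec_mem_unitaryGroup _ _ (by simp only [star_add, star_basisVec]) ?_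
    simp only [add_dotProduct, single_dotProduct, Pi.add_apply, Pi.single_eq_same, map_div₀,
      map_sub, Complex.conj_I, map_one, Pi.single_eq_of_ne hab, Pi.single_eq_of_ne hab.symm,
      Complex.conj_ofNat]
    linear_combination (-1 / 2) * Complex.I_mul_I
  have hmul : (1 + ((Complex.I - 1) / 2) • vecMulVec (basisVec a + basisVec b)
      (basisVec a + basisVec b)) *ᵥ basisVec a =
      ((1 + Complex.I) / 2) • basisVec a + ((Complex.I - 1) / 2) • basisVec b := by
    rw [one_add_smul_vecMulVec_mulVec]
    simp only [add_dotProduct, single_dotProduct, Pi.single_eq_same, Pi.single_eq_of_ne hab.symm]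
    module
  have key := moment_mulVec μ ⟨_, hV⟩ (basisVec a) (basisVec a) (basisVec a) (basisVec a)
  have hz (w x y z : Fin d)
      (h : conj (if w = a then Complex.I else 1) * conj (if x = a then Complex.I else 1) *
        (if y = a then Complex.I else 1) * (if z = a then Complex.I else 1) ≠ (1 : ℂ)) :=
    moment_basisVec_eq_zero μ a w x y z h
  simp only [hmul, moment_comb₁, moment_comb₂, moment_comb₃, moment_comb₄] at key
  have hI : Complex.I ≠ 1 := fun h => by simpa using congrArg Complex.re h
  have hI' : -Complex.I ≠ 1 := fun h => by simpa using congrArg Complex.re h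
  have h2 : (-1 : ℂ) ≠ 1 := by norm_num
  rw [hz a a a b, hz a a b a, hz a b a a, hz b a a a, hz a a b b, hz b b a a, hz a b b b,
    hz b a b b, hz b b a b, hz b b b a, moment_swap_left μ (basisVec b) (basisVec a),
    moment_swap_left μ (basisVec b) (basisVec a), moment_swap_right μ _ _ (basisVec b) (basisVec a)]
    at key
  · simp only [map_div₀, map_add, map_sub, map_one, Complex.conj_I, Complex.conj_ofNat] at key
    ring_nf at key
    simp only [Complex.I_sq, Complex.I_pow_four] at key
    linear_combination -key
  all_goals simp [hab.symm, hI, hI', h2]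

lemma moment_basisVec_eq_two_mul {a b : Fin d} (hab : a ≠ b) :
    moment μ (basisVec a) (basisVec a) (basisVec a) (basisVec a) =
      2 * moment μ (basisVec a) (basisVec b) (basisVec a) (basisVec b) := by
  have h₁ := moment_basisVec_self μ hab
  have h₂ := moment_basisVec_self μ hab.symm
  rw [moment_swap_left μ (basisVec b) (basisVec a),
    moment_swap_right μ (basisVec a) (basisVec b) (basisVec b)] at h₂
  linear_combination (3 / 2) * h₁ + (1 / 2) * h₂

lemma moment_basisVec_self_eq (a : Fin d) :
    (d + 1) * moment μ (basisVec a) (basisVec a) (basisVec a) (basisVec a) = 2 := by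
  have h := sum_moment_basisVec μ a
  have hb : ∀ b ∈ Finset.univ.erase a,
      moment μ (basisVec a) (basisVec b) (basisVec a) (basisVec b) =
        moment μ (basisVec a) (basisVec a) (basisVec a) (basisVec a) / 2 := fun b hb => by
    rw [moment_basisVec_eq_two_mul μ (Finset.ne_of_mem_erase hb).symm]; ring
  rw [← Finset.add_sum_erase _ _ (Finset.mem_univ a), Finset.sum_congr rfl hb, Finset.sum_const,
    Finset.card_erase_of_mem (Finset.mem_univ a), Finset.card_univ, Fintype.card_fin,
    nsmul_eq_mul, Nat.cast_pred (Fin.pos a)] at h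
  linear_combination 2 * h

lemma moment_basisVec (a b c e : Fin d) :
    (d + 1) * moment μ (basisVec a) (basisVec b) (basisVec c) (basisVec e) =
      (if a = c ∧ b = e then 1 else 0) + (if a = e ∧ b = c then 1 else 0) := by
  have hdiag {a b : Fin d} (hab : a ≠ b) :
      (d + 1) * moment μ (basisVec a) (basisVec b) (basisVec a) (basisVec b) = 1 := by
    linear_combination (1 / 2) * moment_basisVec_self_eq μ a -
      ((d + 1) / 2) * moment_basisVec_eq_two_mul μ hab
  have hI : Complex.I ≠ 1 := fun h => by simpa using congrArg Complex.re h
  have hI' : -Complex.I ≠ 1 := fun h => by simpa using congrArg Complex.re h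
  have h2 : (-1 : ℂ) ≠ 1 := by norm_num
  by_cases h₁ : a = c ∧ b = e
  · obtain ⟨rfl, rfl⟩ := h₁
    by_cases hab : a = b
    · subst hab
      rw [moment_basisVec_self_eq]
      norm_num
    · rw [hdiag hab]
      simp [hab]
  by_cases h₂ : a = e ∧ b = c
  · obtain ⟨rfl, rfl⟩ := h₂
    have hab : a ≠ b := fun h => h₁ ⟨h, h.symm⟩
    rw [moment_swap_right, hdiag hab]
    simp [hab]
  rw [if_neg h₁, if_neg h₂, add_zero]
  refine mul_eq_zero_of_right _ ?_
  by_cases hac : a = c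
  · subst hac
    have hbe : e ≠ b := fun h => h₁ ⟨rfl, h.symm⟩
    refine moment_basisVec_eq_zero μ b _ _ _ _ ?_
    by_cases hab : a = b <;> simp [hbe, hab, hI']
  by_cases hae : a = e
  · subst hae
    have hbc : c ≠ b := fun h => h₂ ⟨rfl, h.symm⟩
    refine moment_basisVec_eq_zero μ b _ _ _ _ ?_
    by_cases hab : a = b <;> simp [hbc, hab, hI']
  refine moment_basisVec_eq_zero μ a _ _ _ _ ?_
  by_cases hab : b = a <;> simp [Ne.symm hac, Ne.symm hae, hab, hI', h2]

end Basis

lemma conjTranspose_kronecker_mul_diagonal_mul_kronecker_apply (U : unitaryGroup (Fin d) ℂ)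
    (p q : Fin d × Fin d) :
    ((U.1 ⊗ₖ U.1)ᴴ * diagonal (fun st : Fin d × Fin d => if st.1 = st.2 then (d : ℂ) else -1) *
      (U.1 ⊗ₖ U.1)) p q =
      (d + 1) * rowQuartic (basisVec p.1) (basisVec p.2) (basisVec q.1) (basisVec q.2) U -
        (if p.1 = q.1 then 1 else 0) * (if p.2 = q.2 then 1 else 0) := by
  rw [mul_apply, Fintype.sum_prod_type]
  rw [← sum_conj_mul U, ← sum_conj_mul U, Finset.sum_mul_sum, rowQuartic_basisVec, Finset.mul_sum,
    ← Finset.sum_sub_distrib]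
  refine Finset.sum_congr rfl fun s _ => ?_
  have h : (d + 1 : ℂ) * (conj (U.1 s p.1) * conj (U.1 s p.2) * U.1 s q.1 * U.1 s q.2) =
      ∑ t, if s = t then
        (d + 1 : ℂ) * (conj (U.1 s p.1) * conj (U.1 t p.2) * U.1 s q.1 * U.1 t q.2) else 0 := by
    simp
  rw [h, ← Finset.sum_sub_distrib]
  refine Finset.sum_congr rfl fun t _ => ?_
  simp only [mul_diagonal, conjTranspose_apply, kroneckerMap_apply, ← starRingEnd_apply, map_mul]
  split_ifs <;> ring

end UnitaryTwirl

/-- Second-order twirling of the purity post-processing matrix: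
for Haar-random `U ∈ U(d)`, `∫ (U ⊗ U)† X₂ (U ⊗ U) dμ(U) = S` (entrywise), where `X₂` is the
diagonal matrix with entries `d` (on the diagonal pairs) and `−1` (off-diagonal pairs), and `S`
is the swap operator. -/
theorem twirl_X2_eq_swap {d : ℕ} (hd : 1 ≤ d)
    (μ : Measure (Matrix.unitaryGroup (Fin d) ℂ))
    [μ.IsHaarMeasure] [IsProbabilityMeasure μ] :
    ∀ p q : Fin d × Fin d,
      (∫ U : Matrix.unitaryGroup (Fin d) ℂ,
        ((((U : Matrix (Fin d) (Fin d) ℂ) ⊗ₖ (U : Matrix (Fin d) (Fin d) ℂ))ᴴ *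
          Matrix.diagonal (fun st : Fin d × Fin d => if st.1 = st.2 then (d : ℂ) else -1) *
          ((U : Matrix (Fin d) (Fin d) ℂ) ⊗ₖ (U : Matrix (Fin d) (Fin d) ℂ))) p q) ∂μ) =
      (if p.1 = q.2 ∧ p.2 = q.1 then (1 : ℂ) else 0) := by
  intro p q
  simp only [UnitaryTwirl.conjTranspose_kronecker_mul_diagonal_mul_kronecker_apply]
  rw [integral_sub ((UnitaryTwirl.integrable_rowQuartic μ _ _ _ _).const_mul _)
    (integrable_const _), integral_const_mul, ← UnitaryTwirl.moment, UnitaryTwirl.moment_basisVec]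
  simp only [integral_const, probReal_univ, one_smul, ite_and, mul_ite, mul_one, mul_zero]
  split_ifs <;> simp_all
end

section
/- Let d ≥ 1, let μ be the Haar probability measure on the compact group U(d) of d×d complex unitary matrices, and define x₂(s,t) = d if s = t and x₂(s,t) = −1 otherwise, for s, t ∈ Fin d. Then for every d×d complex matrix σ, ∫ [ Σ_{s,t} x₂(s,t) · (U σ U†)_{ss} · (U σ U†)_{tt} ] dμ(U) = Tr(σ²). -/
open MeasureTheory Matrix

section PurityEstimator

variable {d : ℕ}

/-- The reflection acting on the plane spanned by the basis vectors `s` and `t` by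
`!![3/5, 4/5 * z; 4/5 * conj z, -3/5]`, and trivially on the other basis vectors. -/
noncomputable def planeReflection (s t : Fin d) (z : ℂ) : Matrix (Fin d) (Fin d) ℂ :=
  Matrix.of fun i =>
    if i = s then Pi.single s (3 / 5) + Pi.single t (4 / 5 * z)
    else if i = t then Pi.single s (4 / 5 * star z) + Pi.single t (-3 / 5)
    else Pi.single i 1

theorem planeReflection_mem_unitaryGroup {s t : Fin d} (hst : s ≠ t) {z : ℂ}
    (hz : z * star z = 1) : planeReflection s t z ∈ Matrix.unitaryGroup (Fin d) ℂ := by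
  rw [Matrix.mem_unitaryGroup_iff]
  have hz' : z * (starRingEnd ℂ) z = 1 := hz
  ext i j
  simp only [Matrix.mul_apply, Matrix.star_apply, planeReflection, Matrix.of_apply]
  by_cases his : i = s <;> by_cases hit : i = t <;> by_cases hjs : j = s <;>
    by_cases hjt : j = t <;>
    simp_all [Pi.single_apply, Finset.sum_add_distrib, add_mul, mul_add, Matrix.one_apply,
      apply_ite (starRingEnd ℂ), Complex.conj_ofNat]
  all_goals grind

theorem planeReflection_conj_apply_left (s t : Fin d) (z : ℂ) (M : Matrix (Fin d) (Fin d) ℂ) :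
    (planeReflection s t z * M * (planeReflection s t z)ᴴ) s s =
      9 / 25 * M s s + 16 / 25 * (z * star z) * M t t +
        12 / 25 * (star z * M s t + z * M t s) := by
  simp [Matrix.mul_apply, planeReflection, Pi.single_apply, Finset.sum_add_distrib, add_mul,
    mul_add, apply_ite (starRingEnd ℂ), Complex.conj_ofNat]
  ring

theorem planeReflection_conj_apply_right {s t : Fin d} (hst : s ≠ t) (z : ℂ)
    (M : Matrix (Fin d) (Fin d) ℂ) :
    (planeReflection s t z * M * (planeReflection s t z)ᴴ) t t =
      16 / 25 * (z * star z) * M s s + 9 / 25 * M t t -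
        12 / 25 * (star z * M s t + z * M t s) := by
  simp [Matrix.mul_apply, planeReflection, Pi.single_apply, Finset.sum_add_distrib, add_mul,
    mul_add, apply_ite (starRingEnd ℂ), Complex.conj_ofNat, hst.symm]
  ring

theorem continuous_unitary_conj_apply (σ : Matrix (Fin d) (Fin d) ℂ) (s t : Fin d) :
    Continuous fun U : Matrix.unitaryGroup (Fin d) ℂ =>
      ((U : Matrix (Fin d) (Fin d) ℂ) * σ * (U : Matrix (Fin d) (Fin d) ℂ)ᴴ) s t :=
  Continuous.matrix_elem (by fun_prop) s t

theorem exists_norm_unitary_conj_apply_le (σ : Matrix (Fin d) (Fin d) ℂ) (s t : Fin d) :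
    ∃ C, ∀ U : Matrix.unitaryGroup (Fin d) ℂ,
      ‖((U : Matrix (Fin d) (Fin d) ℂ) * σ * (U : Matrix (Fin d) (Fin d) ℂ)ᴴ) s t‖ ≤ C := by
  refine ⟨∑ k, ∑ j, ‖σ j k‖, fun U => ?_⟩
  rw [Matrix.mul_apply]
  refine norm_sum_le_of_le _ fun k _ => ?_
  rw [norm_mul, Matrix.mul_apply, Matrix.conjTranspose_apply, norm_star]
  refine (mul_le_of_le_one_right (norm_nonneg _) (entry_norm_bound_of_unitary U.2 _ _)).trans ?_
  refine norm_sum_le_of_le _ fun j _ => ?_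
  rw [norm_mul]
  exact mul_le_of_le_one_left (norm_nonneg _) (entry_norm_bound_of_unitary U.2 _ _)

theorem integrable_unitary_conj_apply_mul (μ : Measure (Matrix.unitaryGroup (Fin d) ℂ))
    [IsFiniteMeasure μ] (σ : Matrix (Fin d) (Fin d) ℂ) (i j k l : Fin d) :
    Integrable (fun U : Matrix.unitaryGroup (Fin d) ℂ =>
      ((U : Matrix (Fin d) (Fin d) ℂ) * σ * (U : Matrix (Fin d) (Fin d) ℂ)ᴴ) i j *
        ((U : Matrix (Fin d) (Fin d) ℂ) * σ * (U : Matrix (Fin d) (Fin d) ℂ)ᴴ) k l) μ := by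
  obtain ⟨C, hC⟩ := exists_norm_unitary_conj_apply_le σ i j
  obtain ⟨D, hD⟩ := exists_norm_unitary_conj_apply_le σ k l
  refine Integrable.of_bound (C := C * D) ((continuous_unitary_conj_apply σ i j).mul
    (continuous_unitary_conj_apply σ k l)).aestronglyMeasurable (.of_forall fun U => ?_)
  rw [norm_mul]
  exact mul_le_mul (hC U) (hD U) (norm_nonneg _) ((norm_nonneg _).trans (hC U))

/-- The twirling identity on a coordinate plane. -/
theorem integral_unitary_conj_offDiag_eq (μ : Measure (Matrix.unitaryGroup (Fin d) ℂ))
    [μ.IsMulLeftInvariant] [IsFiniteMeasure μ] (σ : Matrix (Fin d) (Fin d) ℂ) {s t : Fin d}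
    (hst : s ≠ t) (M : Matrix.unitaryGroup (Fin d) ℂ → Matrix (Fin d) (Fin d) ℂ)
    (hM : ∀ U, M U = (U : Matrix (Fin d) (Fin d) ℂ) * σ * (U : Matrix (Fin d) (Fin d) ℂ)ᴴ) :
    (∫ U, M U s s * M U s s ∂μ) + (∫ U, M U t t * M U t t ∂μ) =
      2 * ((∫ U, M U s s * M U t t ∂μ) + ∫ U, M U s t * M U t s ∂μ) := by
  have hint (i j k l : Fin d) : Integrable (fun U => M U i j * M U k l) μ := by
    simpa only [hM] using integrable_unitary_conj_apply_mul μ σ i j k l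
  have key (z : ℂ) (hz : z * star z = 1) :
      ∫ U, M U s s * M U s s + M U t t * M U t t ∂μ =
        ∫ U, ((9 / 25 * M U s s + 16 / 25 * M U t t +
          12 / 25 * (star z * M U s t + z * M U t s)) ^ 2 +
          (16 / 25 * M U s s + 9 / 25 * M U t t -
          12 / 25 * (star z * M U s t + z * M U t s)) ^ 2) ∂μ := by
    rw [← integral_mul_left_eq_self _
      (⟨_, planeReflection_mem_unitaryGroup hst hz⟩ : Matrix.unitaryGroup (Fin d) ℂ)]
    refine integral_congr_ae (.of_forall fun U => ?_)
    have h : M (⟨_, planeReflection_mem_unitaryGroup hst hz⟩ * U) =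
        planeReflection s t z * M U * (planeReflection s t z)ᴴ := by
      simp [hM, Matrix.mul_assoc]
    simp only [h, planeReflection_conj_apply_left, planeReflection_conj_apply_right hst, hz]
    ring
  set N : ℂ → Matrix.unitaryGroup (Fin d) ℂ → ℂ := fun z U =>
    (9 / 25 * M U s s + 16 / 25 * M U t t + 12 / 25 * (star z * M U s t + z * M U t s)) ^ 2 +
      (16 / 25 * M U s s + 9 / 25 * M U t t - 12 / 25 * (star z * M U s t + z * M U t s)) ^ 2
    with hN
  have hNint (z : ℂ) : Integrable (N z) μ := by
    have : N z = fun U => 337 / 625 * (M U s s * M U s s) + 337 / 625 * (M U t t * M U t t) +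
        576 / 625 * (M U s s * M U t t) + 288 / 625 * star z ^ 2 * (M U s t * M U s t) +
        288 / 625 * z ^ 2 * (M U t s * M U t s) + 576 / 625 * (star z * z) * (M U s t * M U t s) -
        168 / 625 * star z * (M U s s * M U s t) - 168 / 625 * z * (M U s s * M U t s) +
        168 / 625 * star z * (M U t t * M U s t) + 168 / 625 * z * (M U t t * M U t s) := by
      funext U
      simp only [hN]
      ring
    rw [this]
    fun_prop
  have hI : Complex.I * star Complex.I = 1 := by simp
  have hsum : 4 * ∫ U, M U s s * M U s s + M U t t * M U t t ∂μ =
      ∫ U, N 1 U + N (-1) U + N Complex.I U + N (-Complex.I) U ∂μ := by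
    have h₁ := integral_add (hNint 1) (hNint (-1))
    have h₂ := integral_add ((hNint 1).add (hNint (-1))) (hNint Complex.I)
    have h₃ := integral_add (((hNint 1).add (hNint (-1))).add (hNint Complex.I))
      (hNint (-Complex.I))
    simp only [Pi.add_apply] at h₂ h₃
    rw [h₃, h₂, h₁, ← key 1 (by simp), ← key (-1) (by simp), ← key Complex.I hI,
      ← key (-Complex.I) (by simp)]
    ring
  have hpoint : (fun U => N 1 U + N (-1) U + N Complex.I U + N (-Complex.I) U) = fun U =>
      1348 / 625 * (M U s s * M U s s + M U t t * M U t t) +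
        2304 / 625 * (M U s s * M U t t + M U s t * M U t s) := by
    funext U
    simp only [hN, Complex.star_def, map_neg, map_one, Complex.conj_I]
    linear_combination (576 / 625 * (M U s t - M U t s) ^ 2) * Complex.I_sq
  have h₁ := integral_add (hint s s s s) (hint t t t t)
  have h₂ := integral_add (hint s s t t) (hint s t t s)
  have h₃ := integral_add (((hint s s s s).add (hint t t t t)).const_mul (1348 / 625))
    (((hint s s t t).add (hint s t t s)).const_mul (2304 / 625))
  simp only [Pi.add_apply, integral_const_mul] at h₃
  rw [hpoint, h₃, h₁, h₂] at hsum
  linear_combination 625 / 1152 * hsum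

end PurityEstimator

/-- Unbiasedness of the randomized-measurement purity estimator: for any
`d × d` matrix `σ`, averaging `Σ_{s,t} x₂(s,t) (UσU†)_{ss} (UσU†)_{tt}` over Haar-random
`U ∈ U(d)` yields `Tr(σ²)`, where `x₂(s,t) = d` if `s = t` and `−1` otherwise. -/
theorem purity_estimator_unbiased {d : ℕ} (hd : 1 ≤ d)
    (μ : Measure (Matrix.unitaryGroup (Fin d) ℂ))
    [μ.IsHaarMeasure] [IsProbabilityMeasure μ]
    (σ : Matrix (Fin d) (Fin d) ℂ) :
    (∫ U : Matrix.unitaryGroup (Fin d) ℂ,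
      (∑ s : Fin d, ∑ t : Fin d,
        (if s = t then (d : ℂ) else -1) *
          (((U : Matrix (Fin d) (Fin d) ℂ) * σ * (U : Matrix (Fin d) (Fin d) ℂ)ᴴ) s s) *
          (((U : Matrix (Fin d) (Fin d) ℂ) * σ * (U : Matrix (Fin d) (Fin d) ℂ)ᴴ) t t)) ∂μ) =
      Matrix.trace (σ * σ) := by
  set M : Matrix.unitaryGroup (Fin d) ℂ → Matrix (Fin d) (Fin d) ℂ :=
    fun U => (U : Matrix (Fin d) (Fin d) ℂ) * σ * (U : Matrix (Fin d) (Fin d) ℂ)ᴴ with hM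
  have hint (i j k l : Fin d) : Integrable (fun U => M U i j * M U k l) μ :=
    integrable_unitary_conj_apply_mul μ σ i j k l
  have htrace : Matrix.trace (σ * σ) = ∑ s, ∑ t, ∫ U, M U s t * M U t s ∂μ := by
    have h (U : Matrix.unitaryGroup (Fin d) ℂ) :
        ∑ s, ∑ t, M U s t * M U t s = Matrix.trace (σ * σ) := by
      have hU : (U : Matrix (Fin d) (Fin d) ℂ)ᴴ * (U : Matrix (Fin d) (Fin d) ℂ) = 1 :=
        Matrix.mem_unitaryGroup_iff'.1 U.2
      calc ∑ s, ∑ t, M U s t * M U t s = Matrix.trace (M U * M U) := by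
            simp [Matrix.trace, Matrix.mul_apply]
        _ = Matrix.trace ((U : Matrix (Fin d) (Fin d) ℂ) * (σ *
              ((U : Matrix (Fin d) (Fin d) ℂ)ᴴ * (U : Matrix (Fin d) (Fin d) ℂ)) * σ) *
              (U : Matrix (Fin d) (Fin d) ℂ)ᴴ) := by simp only [hM, Matrix.mul_assoc]
        _ = Matrix.trace (σ * σ) := by
            rw [hU, Matrix.mul_one, Matrix.trace_mul_comm, ← Matrix.mul_assoc, hU, Matrix.one_mul]
    calc Matrix.trace (σ * σ) = ∫ U, ∑ s, ∑ t, M U s t * M U t s ∂μ := by simp [h]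
      _ = _ := by
        rw [integral_finsetSum _ fun s _ => integrable_finsetSum _ fun t _ => hint _ _ _ _]
        exact Finset.sum_congr rfl fun s _ => integral_finsetSum _ fun t _ => hint _ _ _ _
  have hlhs : (∫ U, ∑ s, ∑ t, (if s = t then (d : ℂ) else -1) * M U s s * M U t t ∂μ) =
      ∑ s, ∑ t, (if s = t then (d : ℂ) else -1) * ∫ U, M U s s * M U t t ∂μ := by
    simp only [mul_assoc]
    rw [integral_finsetSum _ fun s _ => integrable_finsetSum _ fun t _ =>
      (hint _ _ _ _).const_mul _]
    refine Finset.sum_congr rfl fun s _ => ?_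
    rw [integral_finsetSum _ fun t _ => (hint _ _ _ _).const_mul _]
    exact Finset.sum_congr rfl fun t _ => integral_const_mul _ _
  rw [hlhs, htrace]
  have hpair (s t : Fin d) : (∫ U, M U s t * M U t s ∂μ) =
      (if s = t then (d : ℂ) else -1) * (∫ U, M U s s * M U t t ∂μ) +
        (1 / 2 * ((∫ U, M U s s * M U s s ∂μ) + ∫ U, M U t t * M U t t ∂μ) -
          if s = t then d * ∫ U, M U s s * M U s s ∂μ else 0) := by
    by_cases hst : s = t
    · subst hst
      simp only [if_true]
      ring
    · have := integral_unitary_conj_offDiag_eq μ σ hst M fun _ => rfl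
      simp only [hst, if_false]
      linear_combination -(1 / 2) * this
  rw [Finset.sum_congr rfl fun s _ => Finset.sum_congr rfl fun t _ => hpair s t]
  simp only [Finset.sum_add_distrib, Finset.sum_sub_distrib, ← Finset.mul_sum]
  simp [← Finset.mul_sum]
  ring
end

section
/- Let d ≥ 1 and let μ be the Haar probability measure on the compact group U(d) of d×d complex unitary matrices. Let X₃ be the diagonal matrix indexed by triples (s₁,s₂,s₃) ∈ (Fin d)³ whose diagonal entry equals (1 + d²)/2 if s₁ = s₂ = s₃, equals (1 − d)/2 if exactly two of s₁, s₂, s₃ are equal, and equals 1 if s₁, s₂, s₃ are pairwise distinct. Let P_(123) and P_(132) be the two cyclic permutation operators on the 3-fold tensor power, with entries (P_π)_{a,b} = 1 if a_{π(k)} = b_k for all k ∈ {1,2,3} and 0 otherwise, for π the two 3-cycles. Then ∫ U^{⊗3} X₃ (U^{⊗3})† dμ(U) = (1/2)(P_(123) + P_(132)), where U^{⊗3} is the 3-fold Kronecker power of U regarded as a matrix indexed by (Fin d)³. -/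
open MeasureTheory Matrix

/-- The 3-fold tensor (Kronecker) power of a square matrix, indexed by triples. -/
noncomputable def tpow3 {d : ℕ} (A : Matrix (Fin d) (Fin d) ℂ) :
    Matrix (Fin 3 → Fin d) (Fin 3 → Fin d) ℂ :=
  Matrix.of fun a b => ∏ k, A (a k) (b k)

/-- The permutation operator `P_π` on the 3-fold tensor power:
`(P_π)_{a,b} = 1` if `a (π k) = b k` for all `k`, else `0`. -/
noncomputable def permOp3 {d : ℕ} (π : Equiv.Perm (Fin 3)) :
    Matrix (Fin 3 → Fin d) (Fin 3 → Fin d) ℂ :=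
  Matrix.of fun a b => if ∀ k, a (π k) = b k then 1 else 0

/-- The third-order post-processing coefficient:
`(1+d²)/2` if all three indices coincide, `(1−d)/2` if exactly two coincide, `1` otherwise. -/
noncomputable def x3coef (d : ℕ) (s₁ s₂ s₃ : Fin d) : ℂ :=
  if s₁ = s₂ ∧ s₂ = s₃ then (1 + (d : ℂ) ^ 2) / 2
  else if s₁ = s₂ ∨ s₁ = s₃ ∨ s₂ = s₃ then (1 - (d : ℂ)) / 2
  else 1

instance compactSpace_unitaryGroup {n : Type*} [Fintype n] [DecidableEq n] :
    CompactSpace (Matrix.unitaryGroup n ℂ) := by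
  refine isCompact_iff_compactSpace.mp ?_
  refine (isCompact_univ_pi fun _ => isCompact_univ_pi fun _ =>
    isCompact_closedBall (0 : ℂ) 1).of_isClosed_subset (isClosed_unitary (R := Matrix n n ℂ)) ?_
  intro U hU i _ j _
  simpa using entry_norm_bound_of_unitary hU i j

/-- A Haar probability measure on a locally compact group is right invariant. -/
theorem isMulRightInvariant_of_isProbabilityMeasure {G : Type*} [TopologicalSpace G] [Group G]
    [IsTopologicalGroup G] [LocallyCompactSpace G] [MeasurableSpace G] [BorelSpace G]
    (μ : Measure G) [μ.IsHaarMeasure] [IsProbabilityMeasure μ] : μ.IsMulRightInvariant where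
  map_mul_right_eq_self g :=
    haveI := Measure.isProbabilityMeasure_map (μ := μ) (measurable_mul_const g).aemeasurable
    Measure.isHaarMeasure_eq_of_isProbabilityMeasure _ _

/-- Integration of continuous functions on a compact space, as a linear functional. -/
noncomputable def continuousIntegral {X : Type*} [TopologicalSpace X] [CompactSpace X]
    [MeasurableSpace X] [BorelSpace X] (μ : Measure X) [IsFiniteMeasure μ] :
    C(X, ℂ) →ₗ[ℂ] ℂ where
  toFun f := ∫ x, f x ∂μ
  map_add' f g := integral_add
    (f.continuous.integrable_of_hasCompactSupport (.of_compactSpace f))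
    (g.continuous.integrable_of_hasCompactSupport (.of_compactSpace g))
  map_smul' c f := integral_const_mul c f

section Reflection

variable {n : Type*} [Fintype n] [DecidableEq n]

/-- The Householder reflection `1 - (2/5) w w†` for a vector `w` of squared length `5` is
unitary. -/
theorem one_sub_smul_vecMulVec_mem_unitaryGroup (w : n → ℂ) (hw : star w ⬝ᵥ w = 5) :
    1 - (2 / 5 : ℂ) • vecMulVec w (star w) ∈ unitaryGroup n ℂ := by
  rw [mem_unitaryGroup_iff, star_eq_conjTranspose]
  simp only [conjTranspose_sub, conjTranspose_one, conjTranspose_smul, conjTranspose_vecMulVec,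
    star_star, sub_mul, mul_sub, one_mul, mul_one, smul_mul_smul_comm, vecMulVec_mul_vecMulVec,
    hw]
  ext i j
  simp [vecMulVec_apply]
  ring

/-- The reflection sending `e i` to `(3 e i + 4 z e j) / 5`. -/
theorem exists_unitary_mix {i j : n} (hij : i ≠ j) {z : ℂ} (hz : z * star z = 1) :
    ∃ V : unitaryGroup n ℂ, ∀ U : unitaryGroup n ℂ, ∀ a,
      (U * V : unitaryGroup n ℂ).1 a i = (3 * U.1 a i + 4 * z * U.1 a j) / 5 ∧
      ∀ k, k ≠ i → k ≠ j → (U * V : unitaryGroup n ℂ).1 a k = U.1 a k := by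
  let w : n → ℂ := Pi.single i 1 - Pi.single j (2 * z)
  have hw : star w ⬝ᵥ w = 5 := by
    simp [w, dotProduct_sub, hij, hij.symm]
    simp at hz
    linear_combination 4 * hz
  refine ⟨⟨_, one_sub_smul_vecMulVec_mem_unitaryGroup w hw⟩, fun U a => ⟨?_, fun k hi hj => ?_⟩⟩
  · simp [mul_sub, mul_vecMulVec, vecMulVec_apply, w, mulVec_sub, hij]
    ring
  · simp [mul_sub, mul_vecMulVec, vecMulVec_apply, w, hi, hj]

end Reflection

section Moments

variable {d : ℕ}

/-- The matrix entry `U ↦ U i j` as a continuous function on the unitary group. -/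
def entryMap (i j : Fin d) : C(unitaryGroup (Fin d) ℂ, ℂ) :=
  ⟨fun U => U.1 i j, continuous_subtype_val.matrix_elem i j⟩

/-- The balanced monomial `U a₁ i * U a₂ j * U a₃ k * conj (U b₁ i * U b₂ j * U b₃ k)`. -/
noncomputable def balancedMonomial (a₁ a₂ a₃ b₁ b₂ b₃ i j k : Fin d) : C(unitaryGroup (Fin d) ℂ, ℂ) :=
  entryMap a₁ i * entryMap a₂ j * entryMap a₃ k *
    (star (entryMap b₁ i) * star (entryMap b₂ j) * star (entryMap b₃ k))

theorem balancedMonomial_apply (a₁ a₂ a₃ b₁ b₂ b₃ i j k : Fin d) (U : unitaryGroup (Fin d) ℂ) :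
    balancedMonomial a₁ a₂ a₃ b₁ b₂ b₃ i j k U = U.1 a₁ i * U.1 a₂ j * U.1 a₃ k *
      (star (U.1 b₁ i) * star (U.1 b₂ j) * star (U.1 b₃ k)) := rfl

variable (μ : Measure (unitaryGroup (Fin d) ℂ)) [IsFiniteMeasure μ]

/-- The integral of `balancedMonomial`. -/
noncomputable def balancedMoment (a₁ a₂ a₃ b₁ b₂ b₃ i j k : Fin d) : ℂ :=
  continuousIntegral μ (balancedMonomial a₁ a₂ a₃ b₁ b₂ b₃ i j k)

theorem continuousIntegral_comp_mul_right [μ.IsMulRightInvariant]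
    (f : C(unitaryGroup (Fin d) ℂ, ℂ)) (V : unitaryGroup (Fin d) ℂ) :
    continuousIntegral μ (f.comp (ContinuousMap.mulRight V)) = continuousIntegral μ f :=
  integral_mul_right_eq_self (fun U => f U) V

variable {μ} in
/-- Averaging the reflections with phases `1, -1, I, -I` inside an integral. -/
theorem continuousIntegral_eq_of_phase_sum [μ.IsMulRightInvariant] {i j : Fin d} (hij : i ≠ j)
    {f g : C(unitaryGroup (Fin d) ℂ, ℂ)}
    (h : ∀ V : ℂ → unitaryGroup (Fin d) ℂ,
      (∀ z ∈ ({1, -1, Complex.I, -Complex.I} : Set ℂ), ∀ U a,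
        (U * V z).1 a i = (3 * U.1 a i + 4 * z * U.1 a j) / 5 ∧
        ∀ k, k ≠ i → k ≠ j → (U * V z).1 a k = U.1 a k) →
      ∀ U, f (U * V 1) + f (U * V (-1)) + f (U * V Complex.I) + f (U * V (-Complex.I)) =
        4 * g U) :
    continuousIntegral μ f = continuousIntegral μ g := by
  have hex (z : ℂ) : ∃ V : unitaryGroup (Fin d) ℂ,
      z ∈ ({1, -1, Complex.I, -Complex.I} : Set ℂ) → ∀ U : unitaryGroup (Fin d) ℂ, ∀ a,
        (U * V).1 a i = (3 * U.1 a i + 4 * z * U.1 a j) / 5 ∧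
        ∀ k, k ≠ i → k ≠ j → (U * V).1 a k = U.1 a k := by
    by_cases hz : z ∈ ({1, -1, Complex.I, -Complex.I} : Set ℂ)
    · obtain ⟨V, hV⟩ := exists_unitary_mix hij (z := z) (by
        rcases hz with rfl | rfl | rfl | rfl <;> simp)
      exact ⟨V, fun _ => hV⟩
    · exact ⟨1, fun h => absurd h hz⟩
  choose V hV using hex
  have key : f.comp (ContinuousMap.mulRight (V 1)) + f.comp (ContinuousMap.mulRight (V (-1))) +
      f.comp (ContinuousMap.mulRight (V Complex.I)) +
      f.comp (ContinuousMap.mulRight (V (-Complex.I))) = (4 : ℂ) • g := by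
    ext U
    exact h V hV U
  have := congrArg (continuousIntegral μ) key
  simp only [map_add, map_smul, continuousIntegral_comp_mul_right, smul_eq_mul] at this
  linear_combination this / 4

/-- The sum of the nine balanced moments with one column index `j` and two column indices `i`. -/
noncomputable def singleExchangeMoment (a₁ a₂ a₃ b₁ b₂ b₃ i j : Fin d) : ℂ :=
  balancedMoment μ a₁ a₂ a₃ b₁ b₂ b₃ i i j +
    balancedMoment μ a₁ a₂ a₃ b₃ b₁ b₂ i i j +
    balancedMoment μ a₁ a₂ a₃ b₂ b₃ b₁ i i j +
    balancedMoment μ a₁ a₃ a₂ b₁ b₃ b₂ i i j +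
    balancedMoment μ a₁ a₃ a₂ b₃ b₂ b₁ i i j +
    balancedMoment μ a₁ a₃ a₂ b₂ b₁ b₃ i i j +
    balancedMoment μ a₃ a₂ a₁ b₃ b₂ b₁ i i j +
    balancedMoment μ a₃ a₂ a₁ b₂ b₁ b₃ i i j +
    balancedMoment μ a₃ a₂ a₁ b₁ b₃ b₂ i i j

theorem balancedMoment_iii [μ.IsMulRightInvariant] {i j : Fin d} (hij : i ≠ j)
    (a₁ a₂ a₃ b₁ b₂ b₃ : Fin d) :
    14896 * balancedMoment μ a₁ a₂ a₃ b₁ b₂ b₃ i i i -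
        4096 * balancedMoment μ a₁ a₂ a₃ b₁ b₂ b₃ j j j =
      1296 * singleExchangeMoment μ a₁ a₂ a₃ b₁ b₂ b₃ i j +
        2304 * singleExchangeMoment μ a₁ a₂ a₃ b₁ b₂ b₃ j i := by
  let p := fun i j : Fin d =>
    balancedMonomial a₁ a₂ a₃ b₁ b₂ b₃ i i j +
    balancedMonomial a₁ a₂ a₃ b₃ b₁ b₂ i i j +
    balancedMonomial a₁ a₂ a₃ b₂ b₃ b₁ i i j +
    balancedMonomial a₁ a₃ a₂ b₁ b₃ b₂ i i j +
    balancedMonomial a₁ a₃ a₂ b₃ b₂ b₁ i i j +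
    balancedMonomial a₁ a₃ a₂ b₂ b₁ b₃ i i j +
    balancedMonomial a₃ a₂ a₁ b₃ b₂ b₁ i i j +
    balancedMonomial a₃ a₂ a₁ b₂ b₁ b₃ i i j +
    balancedMonomial a₃ a₂ a₁ b₁ b₃ b₂ i i j
  have := continuousIntegral_eq_of_phase_sum (μ := μ) hij
    (f := balancedMonomial a₁ a₂ a₃ b₁ b₂ b₃ i i i)
    (g := (729 / 15625 : ℂ) • balancedMonomial a₁ a₂ a₃ b₁ b₂ b₃ i i i +
      (4096 / 15625 : ℂ) • balancedMonomial a₁ a₂ a₃ b₁ b₂ b₃ j j j +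
      (1296 / 15625 : ℂ) • p i j + (2304 / 15625 : ℂ) • p j i) (by
    intro V hV U
    have h1 := fun a => (hV 1 (by simp) U a).1
    have h2 := fun a => (hV (-1) (by simp) U a).1
    have h3 := fun a => (hV Complex.I (by simp) U a).1
    have h4 := fun a => (hV (-Complex.I) (by simp) U a).1
    simp only [p, ContinuousMap.add_apply, ContinuousMap.smul_apply, balancedMonomial_apply,
      h1, h2, h3, h4]
    simp
    have hI6 : Complex.I ^ 6 = -1 := by rw [show 6 = 2 * 3 from rfl, pow_mul, Complex.I_sq]; ring
    ring_nf
    simp only [Complex.I_sq, Complex.I_pow_four, hI6]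
    ring_nf)
  simp only [p, map_add, map_smul, smul_eq_mul] at this
  simp only [singleExchangeMoment, balancedMoment]
  linear_combination 15625 * this

theorem balancedMoment_iij [μ.IsMulRightInvariant] {i j k : Fin d} (hij : i ≠ j) (hik : i ≠ k)
    (hjk : j ≠ k) (a₁ a₂ a₃ b₁ b₂ b₃ : Fin d) :
    544 * balancedMoment μ a₁ a₂ a₃ b₁ b₂ b₃ i i j -
        256 * balancedMoment μ a₁ a₂ a₃ b₁ b₂ b₃ k k j =
      144 * (balancedMoment μ a₁ a₂ a₃ b₁ b₂ b₃ i k j +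
        balancedMoment μ a₁ a₂ a₃ b₂ b₁ b₃ i k j + balancedMoment μ a₁ a₂ a₃ b₁ b₂ b₃ k i j +
        balancedMoment μ a₁ a₂ a₃ b₂ b₁ b₃ k i j) := by
  have := continuousIntegral_eq_of_phase_sum (μ := μ) hik
    (f := balancedMonomial a₁ a₂ a₃ b₁ b₂ b₃ i i j)
    (g := (81 / 625 : ℂ) • balancedMonomial a₁ a₂ a₃ b₁ b₂ b₃ i i j +
      (256 / 625 : ℂ) • balancedMonomial a₁ a₂ a₃ b₁ b₂ b₃ k k j +
      (144 / 625 : ℂ) • (balancedMonomial a₁ a₂ a₃ b₁ b₂ b₃ i k j +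
        balancedMonomial a₁ a₂ a₃ b₂ b₁ b₃ i k j + balancedMonomial a₁ a₂ a₃ b₁ b₂ b₃ k i j +
        balancedMonomial a₁ a₂ a₃ b₂ b₁ b₃ k i j)) (by
    intro V hV U
    have h1 := fun a => hV 1 (by simp) U a
    have h2 := fun a => hV (-1) (by simp) U a
    have h3 := fun a => hV Complex.I (by simp) U a
    have h4 := fun a => hV (-Complex.I) (by simp) U a
    simp only [ContinuousMap.add_apply, ContinuousMap.smul_apply, balancedMonomial_apply,
      (h1 _).1, (h2 _).1, (h3 _).1, (h4 _).1, (h1 _).2 j hij.symm hjk, (h2 _).2 j hij.symm hjk,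
      (h3 _).2 j hij.symm hjk, (h4 _).2 j hij.symm hjk]
    simp
    ring_nf
    simp only [Complex.I_sq, Complex.I_pow_four]
    ring_nf)
  simp only [map_add, map_smul, smul_eq_mul] at this
  simp only [balancedMoment]
  linear_combination 625 * this

end Moments

section DistinctSums

variable {ι : Type*} [Fintype ι] [DecidableEq ι]

/-- The sum of `F i j` over pairs of distinct indices. -/
noncomputable def distinctPairSum (F : ι → ι → ℂ) : ℂ :=
  ∑ i, ∑ j, if i = j then 0 else F i j

/-- The sum of `F i j k` over triples of pairwise distinct indices. -/
noncomputable def distinctTripleSum (F : ι → ι → ι → ℂ) : ℂ :=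
  ∑ i, ∑ j, ∑ k, if i = j ∨ i = k ∨ j = k then 0 else F i j k

theorem distinctPairSum_congr {F G : ι → ι → ℂ} (h : ∀ i j, i ≠ j → F i j = G i j) :
    distinctPairSum F = distinctPairSum G := by
  unfold distinctPairSum
  refine Finset.sum_congr rfl fun i _ => Finset.sum_congr rfl fun j _ => ?_
  split_ifs with hij
  · rfl
  · exact h i j hij

theorem distinctTripleSum_congr {F G : ι → ι → ι → ℂ}
    (h : ∀ i j k, i ≠ j → i ≠ k → j ≠ k → F i j k = G i j k) :
    distinctTripleSum F = distinctTripleSum G := by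
  unfold distinctTripleSum
  refine Finset.sum_congr rfl fun i _ => Finset.sum_congr rfl fun j _ => Finset.sum_congr rfl fun k _ => ?_
  split_ifs with hijk
  · rfl
  · push Not at hijk
    exact h i j k hijk.1 hijk.2.1 hijk.2.2

theorem distinctPairSum_add (F G : ι → ι → ℂ) :
    distinctPairSum (fun i j => F i j + G i j) = distinctPairSum F + distinctPairSum G := by
  simp only [distinctPairSum, ← Finset.sum_add_distrib]
  refine Finset.sum_congr rfl fun i _ => Finset.sum_congr rfl fun j _ => ?_
  split_ifs <;> simp

theorem distinctPairSum_mul (c : ℂ) (F : ι → ι → ℂ) :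
    distinctPairSum (fun i j => c * F i j) = c * distinctPairSum F := by
  simp [distinctPairSum, Finset.mul_sum]

theorem distinctPairSum_swap (F : ι → ι → ℂ) :
    distinctPairSum (fun i j => F j i) = distinctPairSum F := by
  unfold distinctPairSum
  rw [Finset.sum_comm]
  simp only [eq_comm]

theorem distinctPairSum_fst (f : ι → ℂ) :
    distinctPairSum (fun i _ => f i) = (Fintype.card ι - 1) * ∑ i, f i := by
  have h (i j : ι) : (if i = j then 0 else f i) = f i - if i = j then f i else 0 := by
    split_ifs <;> simp
  simp only [distinctPairSum, h, Finset.sum_sub_distrib]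
  simp [← Finset.mul_sum]
  ring

theorem distinctTripleSum_add (F G : ι → ι → ι → ℂ) :
    distinctTripleSum (fun i j k => F i j k + G i j k) =
      distinctTripleSum F + distinctTripleSum G := by
  simp only [distinctTripleSum, ← Finset.sum_add_distrib]
  refine Finset.sum_congr rfl fun i _ => Finset.sum_congr rfl fun j _ => Finset.sum_congr rfl fun k _ => ?_
  split_ifs <;> simp

theorem distinctTripleSum_mul (c : ℂ) (F : ι → ι → ι → ℂ) :
    distinctTripleSum (fun i j k => c * F i j k) = c * distinctTripleSum F := by
  simp [distinctTripleSum, Finset.mul_sum]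

theorem distinctTripleSum_swap₁₂ (F : ι → ι → ι → ℂ) :
    distinctTripleSum (fun i j k => F j i k) = distinctTripleSum F := by
  unfold distinctTripleSum
  rw [Finset.sum_comm]
  refine Finset.sum_congr rfl fun i _ => Finset.sum_congr rfl fun j _ => Finset.sum_congr rfl fun k _ => ?_
  grind

theorem distinctTripleSum_swap₂₃ (F : ι → ι → ι → ℂ) :
    distinctTripleSum (fun i j k => F i k j) = distinctTripleSum F := by
  unfold distinctTripleSum
  refine Finset.sum_congr rfl fun i _ => ?_
  rw [Finset.sum_comm]
  refine Finset.sum_congr rfl fun j _ => Finset.sum_congr rfl fun k _ => ?_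
  grind

theorem distinctTripleSum_fst_snd (F : ι → ι → ℂ) :
    distinctTripleSum (fun i j _ => F i j) = (Fintype.card ι - 2) * distinctPairSum F := by
  have h (i j k : ι) : (if i = j ∨ i = k ∨ j = k then 0 else F i j) =
      (if i = j then 0 else F i j) - (if i = k then if i = j then 0 else F i j else 0) -
        (if j = k then if i = j then 0 else F i j else 0) := by
    grind
  simp only [distinctTripleSum, distinctPairSum, h, Finset.sum_sub_distrib]
  simp only [Finset.sum_const, Finset.card_univ, nsmul_eq_mul, Finset.sum_ite_eq,
    Finset.mem_univ, if_true, ← Finset.mul_sum]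
  ring

/-- Splitting a sum over triples according to the coincidences among the indices. -/
theorem sum_triple_eq (F : ι → ι → ι → ℂ) :
    ∑ i, ∑ j, ∑ k, F i j k = ∑ i, F i i i + distinctPairSum (fun i j => F i i j) +
      distinctPairSum (fun i j => F i j i) + distinctPairSum (fun i j => F j i i) +
      distinctTripleSum F := by
  have h (i j k : ι) : F i j k =
      (if i = j then if j = k then F i i i else 0 else 0) +
      (if i = j then if i = k then 0 else F i i k else 0) +
      (if i = k then if i = j then 0 else F i j i else 0) +
      (if j = k then if j = i then 0 else F i j j else 0) +
      (if i = j ∨ i = k ∨ j = k then 0 else F i j k) := by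
    grind
  have h3 : ∑ i, ∑ j, ∑ k, (if i = k then if i = j then 0 else F i j i else 0) =
      distinctPairSum (fun i j => F i j i) := by
    simp [distinctPairSum]
  have h4 : ∑ i, ∑ j, ∑ k, (if j = k then if j = i then 0 else F i j j else 0) =
      distinctPairSum (fun i j => F j i i) := by
    rw [← distinctPairSum_swap]
    simp [distinctPairSum, eq_comm]
  have h2 : ∑ i, ∑ j, ∑ k, (if i = j then if i = k then 0 else F i i k else 0) =
      distinctPairSum (fun i j => F i i j) := by
    simp only [distinctPairSum]
    refine Finset.sum_congr rfl fun i _ => ?_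
    rw [Finset.sum_comm]
    simp
  rw [Finset.sum_congr rfl fun i _ => Finset.sum_congr rfl fun j _ =>
    Finset.sum_congr rfl fun k _ => h i j k]
  simp only [Finset.sum_add_distrib]
  rw [h2, h3, h4]
  simp [distinctTripleSum]

end DistinctSums

section Twirl

variable {d : ℕ} (μ : Measure (unitaryGroup (Fin d) ℂ)) [IsFiniteMeasure μ]

theorem balancedMoment_swap₁₂ (a₁ a₂ a₃ b₁ b₂ b₃ i j k : Fin d) :
    balancedMoment μ a₂ a₁ a₃ b₂ b₁ b₃ j i k = balancedMoment μ a₁ a₂ a₃ b₁ b₂ b₃ i j k := by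
  simp only [balancedMoment, balancedMonomial]
  congr 1
  ring

theorem balancedMoment_swap₂₃ (a₁ a₂ a₃ b₁ b₂ b₃ i j k : Fin d) :
    balancedMoment μ a₁ a₃ a₂ b₁ b₃ b₂ i k j = balancedMoment μ a₁ a₂ a₃ b₁ b₂ b₃ i j k := by
  simp only [balancedMoment, balancedMonomial]
  congr 1
  ring

theorem balancedMoment_swap₁₃ (a₁ a₂ a₃ b₁ b₂ b₃ i j k : Fin d) :
    balancedMoment μ a₃ a₂ a₁ b₃ b₂ b₁ k j i = balancedMoment μ a₁ a₂ a₃ b₁ b₂ b₃ i j k := by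
  rw [balancedMoment_swap₁₂, balancedMoment_swap₂₃, balancedMoment_swap₁₂]

theorem sum_balancedMoment_iii [μ.IsMulRightInvariant] (a₁ a₂ a₃ b₁ b₂ b₃ : Fin d) :
    3 * ((d : ℂ) - 1) * ∑ i, balancedMoment μ a₁ a₂ a₃ b₁ b₂ b₃ i i i =
      distinctPairSum (singleExchangeMoment μ a₁ a₂ a₃ b₁ b₂ b₃) := by
  have h := distinctPairSum_congr fun i j hij =>
    balancedMoment_iii μ (i := i) (j := j) hij a₁ a₂ a₃ b₁ b₂ b₃
  simp only [sub_eq_add_neg, ← neg_mul, distinctPairSum_add, distinctPairSum_mul] at h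
  rw [distinctPairSum_swap (singleExchangeMoment μ a₁ a₂ a₃ b₁ b₂ b₃),
    distinctPairSum_swap fun i _ => balancedMoment μ a₁ a₂ a₃ b₁ b₂ b₃ i i i,
    distinctPairSum_fst, Fintype.card_fin] at h
  linear_combination h / 3600

theorem distinctPairSum_balancedMoment [μ.IsMulRightInvariant] (a₁ a₂ a₃ b₁ b₂ b₃ : Fin d) :
    ((d : ℂ) - 2) * distinctPairSum (fun i j => balancedMoment μ a₁ a₂ a₃ b₁ b₂ b₃ i i j) =
      distinctTripleSum (balancedMoment μ a₁ a₂ a₃ b₁ b₂ b₃) +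
        distinctTripleSum (balancedMoment μ a₁ a₂ a₃ b₂ b₁ b₃) := by
  have h := distinctTripleSum_congr fun i j k hij hik hjk =>
    balancedMoment_iij μ (i := i) (j := j) (k := k) hij hik hjk a₁ a₂ a₃ b₁ b₂ b₃
  simp only [sub_eq_add_neg, ← neg_mul, distinctTripleSum_add, distinctTripleSum_mul] at h
  have hr (F : Fin d → Fin d → Fin d → ℂ) :
      distinctTripleSum (fun i j k => F k i j) = distinctTripleSum F := by
    rw [← distinctTripleSum_swap₁₂ F, ← distinctTripleSum_swap₂₃]
  have hs (F : Fin d → Fin d → ℂ) :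
      distinctTripleSum (fun _ j k => F k j) = ((d : ℂ) - 2) * distinctPairSum F := by
    rw [distinctTripleSum_swap₂₃ (fun _ j k => F j k), ← hr (fun _ j k => F j k),
      distinctTripleSum_fst_snd, Fintype.card_fin]
  have h₂₃ (b₁ b₂ b₃ : Fin d) :=
    distinctTripleSum_swap₂₃ (balancedMoment μ a₁ a₂ a₃ b₁ b₂ b₃)
  have hr' (b₁ b₂ b₃ : Fin d) := hr (balancedMoment μ a₁ a₂ a₃ b₁ b₂ b₃)
  rw [distinctTripleSum_fst_snd, hs fun k j => balancedMoment μ a₁ a₂ a₃ b₁ b₂ b₃ k k j,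
    h₂₃, h₂₃, hr', hr', Fintype.card_fin] at h
  linear_combination h / 288

theorem distinctTripleSum_balancedMoment_swap₂₃ (a₁ a₂ a₃ b₁ b₂ b₃ : Fin d) :
    distinctTripleSum (balancedMoment μ a₁ a₃ a₂ b₁ b₃ b₂) =
      distinctTripleSum (balancedMoment μ a₁ a₂ a₃ b₁ b₂ b₃) := by
  rw [← distinctTripleSum_swap₂₃]
  simp only [balancedMoment_swap₂₃]

theorem distinctTripleSum_balancedMoment_swap₁₃ (a₁ a₂ a₃ b₁ b₂ b₃ : Fin d) :
    distinctTripleSum (balancedMoment μ a₃ a₂ a₁ b₃ b₂ b₁) =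
      distinctTripleSum (balancedMoment μ a₁ a₂ a₃ b₁ b₂ b₃) := by
  rw [← distinctTripleSum_swap₁₂, ← distinctTripleSum_swap₂₃, ← distinctTripleSum_swap₁₂]
  simp only [balancedMoment_swap₁₃]

theorem sum_x3coef_mul_balancedMoment (a₁ a₂ a₃ b₁ b₂ b₃ : Fin d) :
    ∑ i, ∑ j, ∑ k, x3coef d i j k * balancedMoment μ a₁ a₂ a₃ b₁ b₂ b₃ i j k =
      (1 + (d : ℂ) ^ 2) / 2 * ∑ i, balancedMoment μ a₁ a₂ a₃ b₁ b₂ b₃ i i i +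
      (1 - (d : ℂ)) / 2 *
        (distinctPairSum (fun i j => balancedMoment μ a₁ a₂ a₃ b₁ b₂ b₃ i i j) +
          distinctPairSum (fun i j => balancedMoment μ a₁ a₃ a₂ b₁ b₃ b₂ i i j) +
          distinctPairSum (fun i j => balancedMoment μ a₃ a₂ a₁ b₃ b₂ b₁ i i j)) +
      distinctTripleSum (balancedMoment μ a₁ a₂ a₃ b₁ b₂ b₃) := by
  rw [sum_triple_eq, Finset.mul_sum]
  simp only [mul_add, ← distinctPairSum_mul, ← add_assoc]
  congr 1
  · congr 1
    · congr 1
      · congr 1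
        · simp [x3coef]
        · refine distinctPairSum_congr fun i j hij => ?_
          simp [x3coef, hij]
      · refine distinctPairSum_congr fun i j hij => ?_
        simp [x3coef, hij, hij.symm, ← balancedMoment_swap₂₃ μ a₁ a₂ a₃ b₁ b₂ b₃ i j i]
    · refine distinctPairSum_congr fun i j hij => ?_
      simp [x3coef, hij.symm, ← balancedMoment_swap₁₃ μ a₁ a₂ a₃ b₁ b₂ b₃ j i i]
  · refine distinctTripleSum_congr fun i j k hij hik hjk => ?_
    simp [x3coef, hij, hik, hjk]

theorem sum_balancedMoment (a₁ a₂ a₃ b₁ b₂ b₃ : Fin d) :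
    ∑ i, ∑ j, ∑ k, balancedMoment μ a₁ a₂ a₃ b₁ b₂ b₃ i j k =
      ∑ i, balancedMoment μ a₁ a₂ a₃ b₁ b₂ b₃ i i i +
      (distinctPairSum (fun i j => balancedMoment μ a₁ a₂ a₃ b₁ b₂ b₃ i i j) +
        distinctPairSum (fun i j => balancedMoment μ a₁ a₃ a₂ b₁ b₃ b₂ i i j) +
        distinctPairSum (fun i j => balancedMoment μ a₃ a₂ a₁ b₃ b₂ b₁ i i j)) +
      distinctTripleSum (balancedMoment μ a₁ a₂ a₃ b₁ b₂ b₃) := by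
  rw [sum_triple_eq]
  have h₂ (i j) := balancedMoment_swap₂₃ μ a₁ a₂ a₃ b₁ b₂ b₃ i j i
  have h₁ (i j) := balancedMoment_swap₁₃ μ a₁ a₂ a₃ b₁ b₂ b₃ j i i
  simp only [h₁, h₂]
  ring

/-- Unitarity evaluates the full sum of balanced moments. -/
theorem sum_balancedMoment_eq_ite [IsProbabilityMeasure μ] (a₁ a₂ a₃ b₁ b₂ b₃ : Fin d) :
    ∑ i, ∑ j, ∑ k, balancedMoment μ a₁ a₂ a₃ b₁ b₂ b₃ i j k =
      if a₁ = b₁ ∧ a₂ = b₂ ∧ a₃ = b₃ then 1 else 0 := by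
  have key : ∑ i, ∑ j, ∑ k, balancedMonomial a₁ a₂ a₃ b₁ b₂ b₃ i j k =
      ContinuousMap.const _ (if a₁ = b₁ ∧ a₂ = b₂ ∧ a₃ = b₃ then 1 else 0) := by
    ext U
    have hU (a b : Fin d) : ∑ i, U.1 a i * star (U.1 b i) = if a = b then 1 else 0 := by
      have := congrFun (congrFun (mem_unitaryGroup_iff.mp U.2) a) b
      simpa [mul_apply, one_apply, star_eq_conjTranspose] using this
    calc _ = (∑ i, U.1 a₁ i * star (U.1 b₁ i)) *
          ((∑ i, U.1 a₂ i * star (U.1 b₂ i)) * ∑ i, U.1 a₃ i * star (U.1 b₃ i)) := by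
          simp only [ContinuousMap.sum_apply, balancedMonomial_apply, Finset.sum_mul]
          simp only [Finset.mul_sum]
          refine Finset.sum_congr rfl fun i _ => Finset.sum_congr rfl fun j _ =>
            Finset.sum_congr rfl fun k _ => ?_
          ring
      _ = _ := by
          rw [hU, hU, hU]
          simp only [ContinuousMap.const_apply]
          split_ifs <;> simp_all
  simp only [balancedMoment, ← map_sum, key]
  simp [continuousIntegral]

theorem sum_x3coef_mul_balancedMoment_eq [μ.IsMulRightInvariant]
    (a₁ a₂ a₃ b₁ b₂ b₃ : Fin d) :
    ∑ i, ∑ j, ∑ k, x3coef d i j k * balancedMoment μ a₁ a₂ a₃ b₁ b₂ b₃ i j k =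
      1 / 2 * (∑ i, ∑ j, ∑ k, balancedMoment μ a₁ a₂ a₃ b₃ b₁ b₂ i j k +
        ∑ i, ∑ j, ∑ k, balancedMoment μ a₁ a₂ a₃ b₂ b₃ b₁ i j k) := by
  have hd₃ (b₁ b₂ b₃) : ∑ i, balancedMoment μ a₁ a₂ a₃ b₃ b₁ b₂ i i i =
      ∑ i, balancedMoment μ a₁ a₂ a₃ b₁ b₂ b₃ i i i := by
    refine Finset.sum_congr rfl fun i _ => ?_
    simp only [balancedMoment, balancedMonomial]
    congr 1
    ring
  have h := sum_balancedMoment_iii μ a₁ a₂ a₃ b₁ b₂ b₃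
  unfold singleExchangeMoment at h
  simp only [distinctPairSum_add] at h
  have e₃ := distinctPairSum_balancedMoment μ a₁ a₂ a₃
  have e₂ := distinctPairSum_balancedMoment μ a₁ a₃ a₂
  have e₁ := distinctPairSum_balancedMoment μ a₃ a₂ a₁
  simp only [fun x y z => distinctTripleSum_balancedMoment_swap₂₃ μ a₁ a₂ a₃ x y z] at e₂
  simp only [fun x y z => distinctTripleSum_balancedMoment_swap₁₃ μ a₁ a₂ a₃ x y z] at e₁
  rw [sum_x3coef_mul_balancedMoment, sum_balancedMoment, sum_balancedMoment, hd₃ b₁ b₂ b₃,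
    ← hd₃ b₂ b₃ b₁]
  linear_combination (d + 1) / 6 * h -
    1 / 3 * (e₃ b₁ b₂ b₃ + e₂ b₁ b₃ b₂ + e₁ b₃ b₂ b₁) +
    1 / 6 * (e₃ b₃ b₁ b₂ + e₃ b₂ b₃ b₁ + e₂ b₃ b₂ b₁ + e₂ b₂ b₁ b₃ + e₁ b₂ b₁ b₃ + e₁ b₁ b₃ b₂)

end Twirl

theorem sum_fin_three_arrow {ι M : Type*} [Fintype ι] [AddCommMonoid M]
    (f : (Fin 3 → ι) → M) : ∑ s, f s = ∑ i, ∑ j, ∑ k, f ![i, j, k] := by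
  rw [← (Fin.consEquiv fun _ => ι).sum_comp, Fintype.sum_prod_type]
  refine Finset.sum_congr rfl fun i _ => ?_
  rw [← (Fin.consEquiv fun _ => ι).sum_comp, Fintype.sum_prod_type]
  refine Finset.sum_congr rfl fun j _ => ?_
  rw [← (Equiv.funUnique (Fin 1) ι).symm.sum_comp]
  refine Finset.sum_congr rfl fun k _ => congrArg f ?_
  ext l
  fin_cases l <;> rfl

/-- Third-order twirling of the `X₃` post-processing matrix: for Haar-random
`U ∈ U(d)`, `∫ U^{⊗3} X₃ (U^{⊗3})† dμ(U) = (1/2)(P₍₁₂₃₎ + P₍₁₃₂₎)` (entrywise), the average of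
the two cyclic permutation operators on the 3-fold tensor power. -/
theorem twirl_X3_eq_cyclic {d : ℕ} (hd : 1 ≤ d)
    (μ : Measure (Matrix.unitaryGroup (Fin d) ℂ))
    [μ.IsHaarMeasure] [IsProbabilityMeasure μ] :
    ∀ a b : Fin 3 → Fin d,
      (∫ U : Matrix.unitaryGroup (Fin d) ℂ,
        ((tpow3 (U : Matrix (Fin d) (Fin d) ℂ) *
          Matrix.diagonal (fun s : Fin 3 → Fin d => x3coef d (s 0) (s 1) (s 2)) *
          (tpow3 (U : Matrix (Fin d) (Fin d) ℂ))ᴴ) a b) ∂μ) =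
      (((1 / 2 : ℂ) • (permOp3 (finRotate 3) + permOp3 (finRotate 3)⁻¹) :
        Matrix (Fin 3 → Fin d) (Fin 3 → Fin d) ℂ) a b) := by
  intro a b
  have := isMulRightInvariant_of_isProbabilityMeasure μ
  have key (U : unitaryGroup (Fin d) ℂ) :
      (tpow3 (U : Matrix (Fin d) (Fin d) ℂ) *
          Matrix.diagonal (fun s : Fin 3 → Fin d => x3coef d (s 0) (s 1) (s 2)) *
          (tpow3 (U : Matrix (Fin d) (Fin d) ℂ))ᴴ) a b =
        (∑ i, ∑ j, ∑ k, x3coef d i j k •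
          balancedMonomial (a 0) (a 1) (a 2) (b 0) (b 1) (b 2) i j k) U := by
    rw [mul_apply, sum_fin_three_arrow]
    simp only [mul_diagonal, conjTranspose_apply, tpow3, of_apply, Fin.prod_univ_three,
      ContinuousMap.sum_apply, ContinuousMap.smul_apply, balancedMonomial_apply, star_mul',
      cons_val_zero, cons_val_one, cons_val, smul_eq_mul]
    refine Finset.sum_congr rfl fun i _ => Finset.sum_congr rfl fun j _ =>
      Finset.sum_congr rfl fun k _ => ?_
    ring
  simp only [key]
  change continuousIntegral μ _ = _
  simp only [map_sum, map_smul, smul_eq_mul]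
  change ∑ i, ∑ j, ∑ k, x3coef d i j k *
    balancedMoment μ (a 0) (a 1) (a 2) (b 0) (b 1) (b 2) i j k = _
  rw [sum_x3coef_mul_balancedMoment_eq, sum_balancedMoment_eq_ite, sum_balancedMoment_eq_ite]
  have h₀ : (finRotate 3)⁻¹ 0 = 2 := by decide
  have h₁ : (finRotate 3)⁻¹ 1 = 0 := by decide
  have h₂ : (finRotate 3)⁻¹ 2 = 1 := by decide
  have r₀ : finRotate 3 0 = 1 := by decide
  have r₁ : finRotate 3 1 = 2 := by decide
  have r₂ : finRotate 3 2 = 0 := by decide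
  simp only [Matrix.smul_apply, Matrix.add_apply, smul_eq_mul, permOp3, of_apply,
    Fin.forall_fin_succ, IsEmpty.forall_iff, and_true,
    Fin.succ_zero_eq_one, Fin.succ_one_eq_two, h₀, h₁, h₂, r₀, r₁, r₂]
  grind
end

section
/- Let d ≥ 1, let μ be the Haar probability measure on the compact group U(d) of d×d complex unitary matrices, and define x₃(s₁,s₂,s₃) = (1 + d²)/2 if s₁ = s₂ = s₃, x₃(s₁,s₂,s₃) = (1 − d)/2 if exactly two of s₁, s₂, s₃ are equal, and x₃(s₁,s₂,s₃) = 1 if they are pairwise distinct. Then for all d×d complex matrices ρ and O, ∫ [ Σ_{s₁,s₂,s₃ ∈ Fin d} x₃(s₁,s₂,s₃) · (U ρ U†)_{s₁s₁} · (U ρ U†)_{s₂s₂} · (U O U†)_{s₃s₃} ] dμ(U) = Tr(O ρ²). -/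
open MeasureTheory Matrix

namespace BraidingEstimator

open scoped Matrix.Norms.L2Operator

instance compactSpace_unitaryGroup (n : Type*) [Fintype n] [DecidableEq n] :
    CompactSpace (unitaryGroup n ℂ) := by
  refine isCompact_iff_compactSpace.mp (IsCompact.of_isClosed_subset
    (isCompact_univ_pi fun _ : n => isCompact_univ_pi fun _ : n =>
      isCompact_closedBall (0 : ℂ) 1) isClosed_unitary ?_)
  intro U hU i _ j _
  simpa using entry_norm_bound_of_unitary hU i j

/-- Integration against a finite measure, as a continuous linear functional on `C(X, ℂ)`. -/
noncomputable def integralL {X : Type*} [TopologicalSpace X] [CompactSpace X] [MeasurableSpace X]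
    [OpensMeasurableSpace X] (μ : Measure X) [IsFiniteMeasure μ] : C(X, ℂ) →L[ℂ] ℂ :=
  LinearMap.mkContinuous
    { toFun := fun f => ∫ x, f x ∂μ
      map_add' := fun f g => integral_add
        (f.continuous.integrable_of_hasCompactSupport (HasCompactSupport.of_compactSpace _))
        (g.continuous.integrable_of_hasCompactSupport (HasCompactSupport.of_compactSpace _))
      map_smul' := fun c f => integral_const_mul c _ }
    (μ.real Set.univ) fun f => by
      rw [mul_comm]
      exact norm_integral_le_of_norm_le_const (.of_forall f.norm_coe_le_norm)

lemma integralL_apply {X : Type*} [TopologicalSpace X] [CompactSpace X] [MeasurableSpace X]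
    [OpensMeasurableSpace X] (μ : Measure X) [IsFiniteMeasure μ] (f : C(X, ℂ)) :
    integralL μ f = ∫ x, f x ∂μ := rfl

lemma isMulRightInvariant_of_compactSpace {G : Type*} [Group G] [TopologicalSpace G]
    [IsTopologicalGroup G] [CompactSpace G] [MeasurableSpace G] [BorelSpace G]
    (μ : Measure G) [μ.IsHaarMeasure] [IsProbabilityMeasure μ] : μ.IsMulRightInvariant where
  map_mul_right_eq_self g := by
    have : IsProbabilityMeasure (μ.map (· * g)) :=
      Measure.isProbabilityMeasure_map (measurable_mul_const g).aemeasurable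
    exact Measure.isHaarMeasure_eq_of_isProbabilityMeasure _ _

section Exp

variable {A : Type*} [NormedRing A] [NormedAlgebra ℂ A] [StarRing A] [ContinuousStar A]
  [CompleteSpace A] [StarModule ℂ A]

lemma exp_smul_I_mem_unitary {X : A} (hX : IsSelfAdjoint X) (t : ℝ) :
    NormedSpace.exp (t • (Complex.I • X)) ∈ unitary A := by
  rw [smul_comm]
  exact (selfAdjoint.expUnitary (t • (⟨X, hX⟩ : selfAdjoint A))).2

lemma hasDerivAt_exp_conj {X : A} (hX : IsSelfAdjoint X) (M : A) :
    HasDerivAt (fun t : ℝ => NormedSpace.exp (t • (Complex.I • X)) * M *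
      star (NormedSpace.exp (t • (Complex.I • X)))) (Complex.I • (X * M - M * X)) 0 := by
  have hexp : HasDerivAt (fun t : ℝ => NormedSpace.exp (t • (Complex.I • X))) (Complex.I • X) 0 := by
    simpa using hasDerivAt_exp_smul_const (𝕂 := ℝ) (Complex.I • X) 0
  have hstar : HasDerivAt (fun t : ℝ => star (NormedSpace.exp (t • (Complex.I • X))))
      (-(Complex.I • X)) 0 := by
    simpa [hX.star_eq] using hexp.star
  convert! (hexp.mul_const M).mul hstar using 1
  simp [sub_eq_add_neg]

end Exp

variable {d : ℕ}

/-- The diagonal entry `(U A U†)_{ss}`, as a continuous function of the unitary matrix `U`. -/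
noncomputable def diagConj (s : Fin d) :
    Matrix (Fin d) (Fin d) ℂ →ₗ[ℂ] C(unitaryGroup (Fin d) ℂ, ℂ) where
  toFun A := ⟨fun U => ((U : Matrix (Fin d) (Fin d) ℂ) * A * (U : Matrix (Fin d) (Fin d) ℂ)ᴴ) s s,
    by fun_prop⟩
  map_add' A B := by ext U; simp [mul_add, add_mul]
  map_smul' c A := by ext U; simp

lemma diagConj_apply (s : Fin d) (A : Matrix (Fin d) (Fin d) ℂ) (U : unitaryGroup (Fin d) ℂ) :
    diagConj s A U = ((U : Matrix (Fin d) (Fin d) ℂ) * A * (U : Matrix (Fin d) (Fin d) ℂ)ᴴ) s s :=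
  rfl

lemma diagConj_one (s : Fin d) : diagConj s 1 = 1 := by
  ext U
  have := mem_unitaryGroup_iff.mp U.2
  rw [star_eq_conjTranspose] at this
  simp [diagConj_apply, this]

lemma sum_diagConj (A : Matrix (Fin d) (Fin d) ℂ) (U : unitaryGroup (Fin d) ℂ) :
    ∑ s, diagConj s A U = A.trace := by
  have := mem_unitaryGroup_iff'.mp U.2
  rw [star_eq_conjTranspose] at this
  change trace ((U : Matrix (Fin d) (Fin d) ℂ) * A * (U : Matrix (Fin d) (Fin d) ℂ)ᴴ) = _
  rw [trace_mul_comm, ← mul_assoc, this, one_mul]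

lemma diagConj_mul_unitary (s : Fin d) (A : Matrix (Fin d) (Fin d) ℂ)
    (U V : unitaryGroup (Fin d) ℂ) :
    diagConj s A (U * V) =
      diagConj s ((V : Matrix (Fin d) (Fin d) ℂ) * A * (V : Matrix (Fin d) (Fin d) ℂ)ᴴ) U := by
  simp [diagConj_apply, mul_assoc]

/-- The third-moment functional of a fixed row of a random unitary matrix. -/
noncomputable def rowMoment (μ : Measure (unitaryGroup (Fin d) ℂ)) [IsFiniteMeasure μ]
    (s : Fin d) (A B C : Matrix (Fin d) (Fin d) ℂ) : ℂ :=
  integralL μ (diagConj s A * diagConj s B * diagConj s C)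

section Moments

variable (μ : Measure (unitaryGroup (Fin d) ℂ)) [IsProbabilityMeasure μ] (s : Fin d)

lemma rowMoment_conj [μ.IsMulRightInvariant] (V : unitaryGroup (Fin d) ℂ)
    (A B C : Matrix (Fin d) (Fin d) ℂ) :
    rowMoment μ s ((V : Matrix (Fin d) (Fin d) ℂ) * A * (V : Matrix (Fin d) (Fin d) ℂ)ᴴ)
      ((V : Matrix (Fin d) (Fin d) ℂ) * B * (V : Matrix (Fin d) (Fin d) ℂ)ᴴ)
      ((V : Matrix (Fin d) (Fin d) ℂ) * C * (V : Matrix (Fin d) (Fin d) ℂ)ᴴ) =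
      rowMoment μ s A B C := by
  simp only [rowMoment, integralL_apply, ContinuousMap.mul_apply, ← diagConj_mul_unitary]
  exact integral_mul_right_eq_self
    (fun U => diagConj s A U * diagConj s B U * diagConj s C U) V

lemma rowMoment_hasDerivAt {A B C : ℝ → Matrix (Fin d) (Fin d) ℂ}
    {A' B' C' : Matrix (Fin d) (Fin d) ℂ} {t : ℝ}
    (hA : HasDerivAt A A' t) (hB : HasDerivAt B B' t) (hC : HasDerivAt C C' t) :
    HasDerivAt (fun x => rowMoment μ s (A x) (B x) (C x))
      (rowMoment μ s A' (B t) (C t) + rowMoment μ s (A t) B' (C t) +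
        rowMoment μ s (A t) (B t) C') t := by
  let L := ((diagConj s).toContinuousLinearMap).restrictScalars ℝ
  have h := (((integralL μ).restrictScalars ℝ).hasFDerivAt).comp_hasDerivAt t
    (((L.hasFDerivAt.comp_hasDerivAt t hA).mul (L.hasFDerivAt.comp_hasDerivAt t hB)).mul
      (L.hasFDerivAt.comp_hasDerivAt t hC))
  convert! h using 1
  have hL (M : Matrix (Fin d) (Fin d) ℂ) : L M = diagConj s M := rfl
  simp [rowMoment, hL, add_mul]

lemma rowMoment_lie_selfAdjoint [μ.IsMulRightInvariant] {X : Matrix (Fin d) (Fin d) ℂ}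
    (hX : IsSelfAdjoint X) (A B C : Matrix (Fin d) (Fin d) ℂ) :
    rowMoment μ s (X * A - A * X) B C + rowMoment μ s A (X * B - B * X) C +
      rowMoment μ s A B (X * C - C * X) = 0 := by
  have hV (t : ℝ) : NormedSpace.exp (t • (Complex.I • X)) ∈ unitaryGroup (Fin d) ℂ :=
    exp_smul_I_mem_unitary hX t
  have hder (M : Matrix (Fin d) (Fin d) ℂ) : HasDerivAt
      (fun t : ℝ => NormedSpace.exp (t • (Complex.I • X)) * M *
        (NormedSpace.exp (t • (Complex.I • X)))ᴴ) (Complex.I • (X * M - M * X)) 0 :=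
    hasDerivAt_exp_conj hX M
  have h := rowMoment_hasDerivAt μ s (hder A) (hder B) (hder C)
  have hc (t : ℝ) := rowMoment_conj μ s ⟨_, hV t⟩ A B C
  simp only [hc] at h
  have h0 := h.unique (hasDerivAt_const _ _)
  have : Complex.I * (rowMoment μ s (X * A - A * X) B C + rowMoment μ s A (X * B - B * X) C +
      rowMoment μ s A B (X * C - C * X)) = 0 := by
    rw [← h0]
    simp [rowMoment, mul_add]
  simpa using this

lemma rowMoment_lie [μ.IsMulRightInvariant] (X A B C : Matrix (Fin d) (Fin d) ℂ) :
    rowMoment μ s (X * A - A * X) B C + rowMoment μ s A (X * B - B * X) C +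
      rowMoment μ s A B (X * C - C * X) = 0 := by
  have h1 := rowMoment_lie_selfAdjoint μ s (realPart X).2 A B C
  have h2 := rowMoment_lie_selfAdjoint μ s (imaginaryPart X).2 A B C
  rw [← realPart_add_I_smul_imaginaryPart X]
  generalize (realPart X : Matrix (Fin d) (Fin d) ℂ) = Y at *
  generalize (imaginaryPart X : Matrix (Fin d) (Fin d) ℂ) = Z at *
  simp only [rowMoment, add_mul, mul_add, smul_mul_assoc, mul_smul_comm, map_add, map_sub,
    map_smul, sub_mul, mul_sub, smul_eq_mul] at *
  linear_combination h1 + Complex.I * h2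

lemma rowMoment_left_comm (A B C : Matrix (Fin d) (Fin d) ℂ) :
    rowMoment μ s A B C = rowMoment μ s B A C := by
  rw [rowMoment, mul_comm (diagConj s A), rowMoment]

lemma rowMoment_right_comm (A B C : Matrix (Fin d) (Fin d) ℂ) :
    rowMoment μ s A B C = rowMoment μ s A C B := by
  rw [rowMoment, mul_right_comm, rowMoment]

lemma sum_diagConj_single_mul_lie (A B : Matrix (Fin d) (Fin d) ℂ) :
    ∑ p, ∑ q, diagConj s (single q p 1 * A) * diagConj s (single p q 1 * B - B * single p q 1) =
      diagConj s A * diagConj s B - diagConj s (B * A) := by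
  ext U
  obtain ⟨U, hU⟩ := U
  have hone : ∑ q, U s q * Uᴴ q s = 1 := by
    have := congrFun (congrFun (mem_unitaryGroup_iff.mp hU) s) s
    simpa [mul_apply] using this
  have hleft (p q : Fin d) (M : Matrix (Fin d) (Fin d) ℂ) :
      (U * (single q p (1 : ℂ) * M) * Uᴴ) s s = U s q * (M * Uᴴ) p s := by
    rw [← mul_assoc, mul_assoc, mul_apply]
    simp [mul_apply, single_apply, ite_and]
  have hright (p q : Fin d) (M : Matrix (Fin d) (Fin d) ℂ) :
      (U * (M * single p q (1 : ℂ)) * Uᴴ) s s = (U * M) s p * Uᴴ q s := by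
    rw [← mul_assoc, mul_assoc, mul_apply]
    simp [mul_apply, single_apply, ite_and]
  simp only [ContinuousMap.sum_apply, ContinuousMap.mul_apply, ContinuousMap.sub_apply, map_sub,
    diagConj_apply, hleft, hright]
  have hA : (U * A * Uᴴ) s s = ∑ p, U s p * (A * Uᴴ) p s := by rw [mul_assoc, mul_apply]
  have hB : (U * B * Uᴴ) s s = ∑ q, U s q * (B * Uᴴ) q s := by rw [mul_assoc, mul_apply]
  have hBA : (U * (B * A) * Uᴴ) s s =
      (∑ p, (U * B) s p * (A * Uᴴ) p s) * ∑ q, U s q * Uᴴ q s := by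
    rw [hone, mul_one, ← mul_assoc, mul_assoc, mul_apply]
  rw [hA, hB, hBA, Finset.sum_mul_sum, Finset.sum_mul_sum, ← Finset.sum_sub_distrib]
  refine Finset.sum_congr rfl fun p _ => ?_
  rw [← Finset.sum_sub_distrib]
  exact Finset.sum_congr rfl fun q _ => by ring

lemma sum_rowMoment_single_mul_lie (A B C : Matrix (Fin d) (Fin d) ℂ) :
    ∑ p, ∑ q, rowMoment μ s (single q p 1 * A) (single p q 1 * B - B * single p q 1) C =
      rowMoment μ s A B C - rowMoment μ s 1 (B * A) C := by
  simp only [rowMoment, ← map_sum, ← Finset.sum_mul]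
  rw [sum_diagConj_single_mul_lie, diagConj_one, one_mul, sub_mul, map_sub]

lemma sum_lie_single_mul (A : Matrix (Fin d) (Fin d) ℂ) :
    ∑ p, ∑ q, (single p q (1 : ℂ) * (single q p 1 * A) - single q p 1 * A * single p q 1) =
      (d : ℂ) • A - A.trace • 1 := by
  have h1 : ∑ p : Fin d, single p p (1 : ℂ) = 1 := by
    ext i j
    simp [Matrix.sum_apply, single_apply, one_apply, ite_and]
  have h2 (p q : Fin d) : single q p 1 * A * single p q (1 : ℂ) = A p p • single q q 1 := by
    ext i j
    simp [mul_apply, single_apply, ite_and]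
    split_ifs <;> rfl
  simp only [h2, ← mul_assoc, single_mul_single_same, mul_one, Finset.sum_sub_distrib,
    Finset.sum_const, ← Finset.smul_sum, ← Finset.sum_smul, ← Finset.sum_mul, h1]
  simp [trace, -nsmul_eq_mul, Nat.cast_smul_eq_nsmul]

lemma rowMoment_recursion [μ.IsMulRightInvariant] (A B C : Matrix (Fin d) (Fin d) ℂ) :
    (d + 2) * rowMoment μ s A B C = A.trace * rowMoment μ s 1 B C +
      rowMoment μ s 1 (B * A) C + rowMoment μ s 1 B (C * A) := by
  have h : ∑ p, ∑ q, (_ : ℂ) = 0 := Finset.sum_eq_zero fun p _ => Finset.sum_eq_zero fun q _ =>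
    rowMoment_lie μ s (single p q 1) (single q p 1 * A) B C
  have h1 : ∑ p, ∑ q, rowMoment μ s
      (single p q (1 : ℂ) * (single q p 1 * A) - single q p 1 * A * single p q 1) B C =
      d * rowMoment μ s A B C - A.trace * rowMoment μ s 1 B C := by
    simp only [rowMoment, ← map_sum, ← Finset.sum_mul, sum_lie_single_mul]
    simp [sub_mul]
  have h3 : ∑ p, ∑ q, rowMoment μ s (single q p 1 * A) B (single p q 1 * C - C * single p q 1) =
      rowMoment μ s A B C - rowMoment μ s 1 B (C * A) := by
    simp only [rowMoment_right_comm μ s _ B, sum_rowMoment_single_mul_lie]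
  simp only [Finset.sum_add_distrib] at h
  rw [h1, sum_rowMoment_single_mul_lie, h3] at h
  linear_combination h

lemma rowMoment_one : rowMoment μ s 1 1 1 = 1 := by
  simp [rowMoment, diagConj_one, integralL_apply]

lemma rowMoment_one_one [μ.IsMulRightInvariant] (A : Matrix (Fin d) (Fin d) ℂ) :
    d * rowMoment μ s 1 1 A = A.trace := by
  have h := rowMoment_recursion μ s A 1 1
  simp only [one_mul, rowMoment_one, rowMoment_left_comm μ s A 1, rowMoment_right_comm μ s 1 A] at h
  linear_combination h

lemma rowMoment_one_left [μ.IsMulRightInvariant] (A B : Matrix (Fin d) (Fin d) ℂ) :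
    d * (d + 1) * rowMoment μ s 1 A B = A.trace * B.trace + (A * B).trace := by
  have h := rowMoment_recursion μ s A 1 B
  rw [rowMoment_left_comm μ s A 1, one_mul] at h
  have hB := rowMoment_one_one μ s B
  have hBA := rowMoment_one_one μ s (B * A)
  rw [trace_mul_comm] at hBA
  linear_combination d * h + A.trace * hB + hBA

lemma rowMoment_eq [μ.IsMulRightInvariant] (A B C : Matrix (Fin d) (Fin d) ℂ) :
    d * (d + 1) * (d + 2) * rowMoment μ s A B C =
      A.trace * B.trace * C.trace + A.trace * (B * C).trace + (B * A).trace * C.trace +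
        B.trace * (C * A).trace + (B * A * C).trace + (B * (C * A)).trace := by
  linear_combination d * (d + 1) * rowMoment_recursion μ s A B C +
    A.trace * rowMoment_one_left μ s B C + rowMoment_one_left μ s (B * A) C +
    rowMoment_one_left μ s B (C * A)

end Moments

lemma x3coef_eq (s₁ s₂ s₃ : Fin d) :
    x3coef d s₁ s₂ s₃ = 1 - (d + 1) / 2 * ((if s₁ = s₂ then 1 else 0) +
      (if s₁ = s₃ then 1 else 0) + (if s₂ = s₃ then 1 else 0)) +
      (d + 1) * (d + 2) / 2 * (if s₁ = s₂ then if s₂ = s₃ then 1 else 0 else 0) := by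
  unfold x3coef
  split_ifs <;> first | (exfalso; grind) | ring

lemma sum_x3coef (p o : Fin d → ℂ) :
    ∑ s₁, ∑ s₂, ∑ s₃, x3coef d s₁ s₂ s₃ * p s₁ * p s₂ * o s₃ =
      (∑ s, p s) ^ 2 * ∑ s, o s -
        (d + 1) / 2 * ((∑ s, p s * p s) * ∑ s, o s + 2 * (∑ s, p s) * ∑ s, p s * o s) +
        (d + 1) * (d + 2) / 2 * ∑ s, p s * p s * o s := by
  have h0 : ∑ s₁, ∑ s₂, ∑ s₃, p s₁ * p s₂ * o s₃ = (∑ s, p s) ^ 2 * ∑ s, o s := by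
    simp only [sq, ← Finset.mul_sum, ← Finset.sum_mul]
  have h12 : ∑ s₁, ∑ s₂, ∑ s₃, (if s₁ = s₂ then p s₁ * p s₂ * o s₃ else 0) =
      (∑ s, p s * p s) * ∑ s, o s := by
    simp only [Finset.sum_ite_irrel, Finset.sum_const_zero, Finset.sum_ite_eq, Finset.mem_univ,
      if_true, ← Finset.mul_sum, Finset.sum_mul]
  have h13 : ∑ s₁, ∑ s₂, ∑ s₃, (if s₁ = s₃ then p s₁ * p s₂ * o s₃ else 0) =
      (∑ s, p s) * ∑ s, p s * o s := by
    simp only [Finset.sum_ite_eq, Finset.mem_univ, if_true]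
    rw [Finset.sum_comm, Finset.sum_mul_sum]
    exact Finset.sum_congr rfl fun _ _ => Finset.sum_congr rfl fun _ _ => by ring
  have h23 : ∑ s₁, ∑ s₂, ∑ s₃, (if s₂ = s₃ then p s₁ * p s₂ * o s₃ else 0) =
      (∑ s, p s) * ∑ s, p s * o s := by
    simp only [Finset.sum_ite_eq, Finset.mem_univ, if_true, mul_assoc, Finset.sum_mul_sum]
  have h123 : ∑ s₁, ∑ s₂, ∑ s₃,
      (if s₁ = s₂ then if s₂ = s₃ then p s₁ * p s₂ * o s₃ else 0 else 0) =
      ∑ s, p s * p s * o s := by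
    simp only [Finset.sum_ite_irrel, Finset.sum_const_zero, Finset.sum_ite_eq, Finset.mem_univ,
      if_true]
  have hterm (s₁ s₂ s₃ : Fin d) : x3coef d s₁ s₂ s₃ * p s₁ * p s₂ * o s₃ =
      p s₁ * p s₂ * o s₃ - (d + 1) / 2 * ((if s₁ = s₂ then p s₁ * p s₂ * o s₃ else 0) +
      (if s₁ = s₃ then p s₁ * p s₂ * o s₃ else 0) +
      (if s₂ = s₃ then p s₁ * p s₂ * o s₃ else 0)) + (d + 1) * (d + 2) / 2 *
      (if s₁ = s₂ then if s₂ = s₃ then p s₁ * p s₂ * o s₃ else 0 else 0) := by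
    rw [x3coef_eq]
    split_ifs <;> ring
  simp only [hterm, Finset.sum_add_distrib, Finset.sum_sub_distrib]
  rw [h0]
  simp only [← Finset.mul_sum, Finset.sum_add_distrib]
  rw [h12, h13, h23, h123]
  ring

lemma sum_x3coef_diagConj (ρ O : Matrix (Fin d) (Fin d) ℂ) (U : unitaryGroup (Fin d) ℂ) :
    ∑ s₁, ∑ s₂, ∑ s₃, x3coef d s₁ s₂ s₃ * diagConj s₁ ρ U * diagConj s₂ ρ U * diagConj s₃ O U =
      ((ρ.trace ^ 2 * O.trace) • (1 : C(unitaryGroup (Fin d) ℂ, ℂ)) -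
        ((d + 1) / 2 : ℂ) • (O.trace • ∑ s, diagConj s 1 * diagConj s ρ * diagConj s ρ +
          (2 * ρ.trace) • ∑ s, diagConj s 1 * diagConj s ρ * diagConj s O) +
        ((d + 1) * (d + 2) / 2 : ℂ) • ∑ s, diagConj s ρ * diagConj s ρ * diagConj s O) U := by
  rw [sum_x3coef (fun s => diagConj s ρ U) (fun s => diagConj s O U)]
  simp only [sum_diagConj, diagConj_one, one_mul, ContinuousMap.add_apply, ContinuousMap.sub_apply,
    ContinuousMap.smul_apply, ContinuousMap.sum_apply, ContinuousMap.mul_apply,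
    ContinuousMap.one_apply, smul_eq_mul]
  ring

end BraidingEstimator

open BraidingEstimator

/-- Unbiasedness of the braiding-randomized-measurement estimator:
for all `d × d` matrices `ρ` and `O`, averaging
`Σ_{s₁,s₂,s₃} x₃(s₁,s₂,s₃) (UρU†)_{s₁s₁} (UρU†)_{s₂s₂} (UOU†)_{s₃s₃}` over Haar-random
`U ∈ U(d)` yields `Tr(Oρ²)`. -/
theorem braiding_estimator_unbiased {d : ℕ} (hd : 1 ≤ d)
    (μ : Measure (Matrix.unitaryGroup (Fin d) ℂ))
    [μ.IsHaarMeasure] [IsProbabilityMeasure μ]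
    (ρ O : Matrix (Fin d) (Fin d) ℂ) :
    (∫ U : Matrix.unitaryGroup (Fin d) ℂ,
      (∑ s₁ : Fin d, ∑ s₂ : Fin d, ∑ s₃ : Fin d,
        x3coef d s₁ s₂ s₃ *
          (((U : Matrix (Fin d) (Fin d) ℂ) * ρ * (U : Matrix (Fin d) (Fin d) ℂ)ᴴ) s₁ s₁) *
          (((U : Matrix (Fin d) (Fin d) ℂ) * ρ * (U : Matrix (Fin d) (Fin d) ℂ)ᴴ) s₂ s₂) *
          (((U : Matrix (Fin d) (Fin d) ℂ) * O * (U : Matrix (Fin d) (Fin d) ℂ)ᴴ) s₃ s₃)) ∂μ) =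
      Matrix.trace (O * (ρ * ρ)) := by
  have := isMulRightInvariant_of_compactSpace μ
  have hd0 : (d : ℂ) ≠ 0 := by exact_mod_cast (by omega : d ≠ 0)
  have hd1 : (d : ℂ) + 1 ≠ 0 := by exact_mod_cast d.succ_ne_zero
  have hd2 : (d : ℂ) + 2 ≠ 0 := by exact_mod_cast (d + 1).succ_ne_zero
  simp only [← diagConj_apply, sum_x3coef_diagConj]
  rw [← integralL_apply]
  have hone : integralL μ 1 = 1 := by
    simp [integralL_apply]
  have h2 (A B : Matrix (Fin d) (Fin d) ℂ) :
      ∑ s, rowMoment μ s 1 A B =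
        (A.trace * B.trace + (A * B).trace) / (d + 1) := by
    have (s : Fin d) : rowMoment μ s 1 A B =
        (A.trace * B.trace + (A * B).trace) / (d * (d + 1)) := by
      rw [eq_div_iff (by simp [hd0, hd1]), ← rowMoment_one_left μ s]
      ring
    simp only [this, Finset.sum_const, Finset.card_univ, Fintype.card_fin, nsmul_eq_mul]
    field_simp
  have h3 : ∑ s, rowMoment μ s ρ ρ O =
      (ρ.trace ^ 2 * O.trace + 2 * (ρ.trace * (O * ρ).trace) + (ρ * ρ).trace * O.trace +
        2 * (O * (ρ * ρ)).trace) / ((d + 1) * (d + 2)) := by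
    have (s : Fin d) : rowMoment μ s ρ ρ O =
        (ρ.trace ^ 2 * O.trace + 2 * (ρ.trace * (O * ρ).trace) + (ρ * ρ).trace * O.trace +
          2 * (O * (ρ * ρ)).trace) / (d * (d + 1) * (d + 2)) := by
      have h := rowMoment_eq μ s ρ ρ O
      rw [trace_mul_comm ρ O, trace_mul_comm (ρ * ρ) O, trace_mul_comm ρ (O * ρ), mul_assoc O] at h
      rw [eq_div_iff (by simp [hd0, hd1, hd2])]
      linear_combination h
    simp only [this, Finset.sum_const, Finset.card_univ, Fintype.card_fin, nsmul_eq_mul]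
    field_simp
  unfold rowMoment at h2 h3
  simp only [map_add, map_sub, map_smul, map_sum, smul_eq_mul, h2, h3, hone, trace_mul_comm ρ O]
  field_simp
  ring
end

section
/- Let d ≥ 1 and let μ be the Haar probability measure on the compact group U(d) of d×d complex unitary matrices. Let Y be the diagonal matrix indexed by Fin d × Fin d whose diagonal entry at (s,t) equals d² if s = t and 1 otherwise (the entrywise square of the purity post-processing function x₂). Let S be the swap operator with entries S_{(a,b),(c,e)} = 1 if a = e and b = c, and 0 otherwise, and let I be the identity on Fin d × Fin d. Then ∫ U^{⊗2} Y (U^{⊗2})† dμ(U) = d·I + (d − 1)·S. -/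
open MeasureTheory Matrix Kronecker

/-- The fourth moment `∫ U_{as} U_{bs} conj(U_{cs}) conj(U_{es}) dμ(U)` of column `s`. -/
noncomputable def columnMoment {d : ℕ} (μ : Measure (unitaryGroup (Fin d) ℂ))
    (s a b c e : Fin d) : ℂ :=
  ∫ U : unitaryGroup (Fin d) ℂ, U.1 a s * U.1 b s * star (U.1 c s) * star (U.1 e s) ∂μ

section ColumnMoment

variable {d : ℕ} (μ : Measure (unitaryGroup (Fin d) ℂ))

lemma integrable_columnMoment [IsFiniteMeasure μ] (s a b c e : Fin d) :
    Integrable (fun U : unitaryGroup (Fin d) ℂ =>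
      U.1 a s * U.1 b s * star (U.1 c s) * star (U.1 e s)) μ := by
  have hc (i : Fin d) : Continuous fun U : unitaryGroup (Fin d) ℂ => U.1 i s :=
    continuous_subtype_val.matrix_elem i s
  refine Integrable.of_bound (C := 1) (Continuous.aestronglyMeasurable
    ((((hc a).mul (hc b)).mul (hc c).star).mul (hc e).star)) (ae_of_all _ fun U => ?_)
  have hb (i : Fin d) : ‖U.1 i s‖ ≤ 1 := entry_norm_bound_of_unitary U.2 i s
  simp only [norm_mul, norm_star]
  exact mul_le_one₀ (mul_le_one₀ (mul_le_one₀ (hb a) (norm_nonneg _) (hb b)) (norm_nonneg _)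
    (hb c)) (norm_nonneg _) (hb e)

lemma columnMoment_swap_left (s a b c e : Fin d) :
    columnMoment μ s b a c e = columnMoment μ s a b c e := by
  simp only [columnMoment, mul_comm]

lemma columnMoment_eq_integral_mul [μ.IsMulLeftInvariant] (s a b c e : Fin d)
    {V : Matrix (Fin d) (Fin d) ℂ} (hV : V ∈ unitaryGroup (Fin d) ℂ) :
    columnMoment μ s a b c e = ∫ U : unitaryGroup (Fin d) ℂ,
      (V * U.1) a s * (V * U.1) b s * star ((V * U.1) c s) * star ((V * U.1) e s) ∂μ :=
  (integral_mul_left_eq_self (μ := μ) (fun U : unitaryGroup (Fin d) ℂ =>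
    U.1 a s * U.1 b s * star (U.1 c s) * star (U.1 e s)) ⟨V, hV⟩).symm

lemma columnMoment_eq_phase_mul [μ.IsMulLeftInvariant] (s a b c e : Fin d) {v : Fin d → ℂ}
    (hv : ∀ i, v i * star (v i) = 1) :
    columnMoment μ s a b c e =
      v a * v b * star (v c) * star (v e) * columnMoment μ s a b c e := by
  have hV : diagonal v ∈ unitaryGroup (Fin d) ℂ := by
    rw [mem_unitaryGroup_iff, star_eq_conjTranspose, diagonal_conjTranspose,
      diagonal_mul_diagonal, ← diagonal_one]
    exact congrArg diagonal (funext hv)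
  conv_lhs => rw [columnMoment_eq_integral_mul μ s a b c e hV]
  rw [columnMoment, ← integral_const_mul]
  congr 1 with U
  simp only [diagonal_mul, star_mul']
  ring

lemma columnMoment_eq_zero [μ.IsMulLeftInvariant] (s a b c e : Fin d)
    (h : ¬(a = c ∧ b = e)) (h' : ¬(a = e ∧ b = c)) : columnMoment μ s a b c e = 0 := by
  have key (k : Fin d) := columnMoment_eq_phase_mul μ s a b c e
    (v := fun i => if i = k then Complex.I else 1)
    (fun i => by split_ifs <;> simp)
  have zero_of {z w : ℂ} (hz : w = z * w) (hz1 : z ≠ 1) : w = 0 := by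
    by_contra hw
    exact hz1 (mul_right_cancel₀ hw (by rw [one_mul]; exact hz.symm))
  have hI : Complex.I ≠ 1 := fun h => by simpa using congrArg Complex.re h
  have hI' : -Complex.I ≠ 1 := fun h => by simpa using congrArg Complex.re h
  have hn : (-1 : ℂ) ≠ 1 := by norm_num
  by_cases hac : a = c
  · subst hac
    have hbe : b ≠ e := fun hbe => h ⟨rfl, hbe⟩
    refine zero_of (key e) ?_
    by_cases hae : a = e <;> simp [hae, hbe, hI']
  by_cases hae : a = e
  · subst hae
    have hbc : b ≠ c := fun hbc => h' ⟨rfl, hbc⟩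
    refine zero_of (key c) ?_
    simp [hac, hbc, hI']
  · refine zero_of (key a) ?_
    by_cases hba : b = a <;> simp [hba, Ne.symm hac, Ne.symm hae, hI, hn]

lemma exists_mem_unitaryGroup_mul_row {d : ℕ} {a b : Fin d} (hab : a ≠ b) :
    ∃ V ∈ unitaryGroup (Fin d) ℂ, ∀ (A : Matrix (Fin d) (Fin d) ℂ) (s : Fin d),
      (V * A) a s = 3 / 5 * A a s - 4 / 5 * A b s := by
  set W : Matrix (Fin d) (Fin d) ℂ := single a a (2 / 5) + single a b (4 / 5) +
    single b a (4 / 5) + single b b (8 / 5) with hW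
  have hWW : W * W = (2 : ℂ) • W := by
    simp only [hW, add_mul, mul_add, single_mul_single_same, smul_add, smul_single, ne_eq, hab,
      hab.symm, not_false_eq_true, single_mul_single_of_ne]
    ext i j
    simp only [Matrix.add_apply, Matrix.zero_apply, single_apply]
    split_ifs <;> norm_num
  have hWs : star W = W := by
    simp only [hW, star_eq_conjTranspose, conjTranspose_add, conjTranspose_single]
    simp
    abel
  have hV : 1 - W ∈ unitaryGroup (Fin d) ℂ := by
    rw [mem_unitaryGroup_iff, star_sub, star_one, hWs, sub_mul, mul_sub, mul_sub, hWW, two_smul]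
    simp
  refine ⟨1 - W, hV, fun A s => ?_⟩
  simp [hW, sub_mul, add_mul, hab]
  ring

lemma columnMoment_reflection [μ.IsMulLeftInvariant] [IsFiniteMeasure μ] (s : Fin d)
    {a b : Fin d} (hab : a ≠ b) :
    columnMoment μ s a a a a = (3 / 5) ^ 4 * columnMoment μ s a a a a +
      (4 / 5) ^ 4 * columnMoment μ s b b b b +
      4 * (3 / 5) ^ 2 * (4 / 5) ^ 2 * columnMoment μ s a b a b := by
  obtain ⟨V, hV, hrow⟩ := exists_mem_unitaryGroup_mul_row hab
  have hexp := columnMoment_eq_integral_mul μ s a a a a hV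
  simp only [hrow] at hexp
  obtain ⟨f, hfU⟩ : ∃ f : Fin d → Fin d → Fin d → Fin d → unitaryGroup (Fin d) ℂ → ℂ,
      f = fun i j k l U => U.1 i s * U.1 j s * star (U.1 k s) * star (U.1 l s) := ⟨_, rfl⟩
  have hf (r : ℂ) (i j k l : Fin d) : Integrable (fun U => r * f i j k l U) μ := by
    subst hfU
    exact (integrable_columnMoment μ s i j k l).const_mul r
  have hm (i j k l : Fin d) : ∫ U, f i j k l U ∂μ = columnMoment μ s i j k l := by
    subst hfU
    rfl
  have hz (i j k l : Fin d) (h : ¬(i = k ∧ j = l)) (h' : ¬(i = l ∧ j = k)) :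
      ∫ U, f i j k l U ∂μ = 0 :=
    (hm i j k l).trans (columnMoment_eq_zero μ s i j k l h h')
  have hexpand (U : unitaryGroup (Fin d) ℂ) :
      (3 / 5 * U.1 a s - 4 / 5 * U.1 b s) * (3 / 5 * U.1 a s - 4 / 5 * U.1 b s) *
        star (3 / 5 * U.1 a s - 4 / 5 * U.1 b s) * star (3 / 5 * U.1 a s - 4 / 5 * U.1 b s) =
      (3 / 5) ^ 4 * f a a a a U + (4 / 5) ^ 4 * f b b b b U +
        4 * (3 / 5) ^ 2 * (4 / 5) ^ 2 * f a b a b U +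
        (3 / 5) ^ 2 * (4 / 5) ^ 2 * f a a b b U + (3 / 5) ^ 2 * (4 / 5) ^ 2 * f b b a a U +
        (-2 * (3 / 5) ^ 3 * (4 / 5)) * f a a a b U + (-2 * (3 / 5) ^ 3 * (4 / 5)) * f a b a a U +
        (-2 * (3 / 5) * (4 / 5) ^ 3) * f a b b b U +
        (-2 * (3 / 5) * (4 / 5) ^ 3) * f b b a b U := by
    have h3 : star (3 / 5 : ℂ) = 3 / 5 := by simp
    have h4 : star (4 / 5 : ℂ) = 4 / 5 := by simp
    simp only [hfU, star_sub, star_mul', h3, h4]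
    ring
  simp only [hexpand] at hexp
  iterate 8 rw [integral_add] at hexp
  · simp only [integral_const_mul] at hexp
    rw [hz a a b b (by simp [hab]) (by simp [hab]),
      hz b b a a (by simp [hab.symm]) (by simp [hab.symm]),
      hz a a a b (by simp [hab]) (by simp [hab]), hz a b a a (by simp [hab.symm])
      (by simp [hab.symm]), hz a b b b (by simp [hab]) (by simp [hab]),
      hz b b a b (by simp [hab.symm]) (by simp [hab.symm])] at hexp
    simpa [hm] using hexp
  all_goals
    repeat' first
      | exact hf _ _ _ _ _
      | refine Integrable.fun_add ?_ ?_

lemma columnMoment_diag [μ.IsMulLeftInvariant] [IsFiniteMeasure μ] (s a b : Fin d) :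
    columnMoment μ s a a a a = columnMoment μ s b b b b := by
  rcases eq_or_ne a b with rfl | hab
  · rfl
  have h1 := columnMoment_reflection μ s hab
  have h2 := columnMoment_reflection μ s hab.symm
  have h3 : columnMoment μ s b a b a = columnMoment μ s a b a b := by
    simp only [columnMoment]
    congr 1 with U
    ring
  rw [h3] at h2
  linear_combination (25 / 32) * (h1 - h2)

lemma columnMoment_pair [μ.IsMulLeftInvariant] [IsFiniteMeasure μ] (s : Fin d) {a b : Fin d}
    (hab : a ≠ b) : columnMoment μ s a b a b = columnMoment μ s a a a a / 2 := by
  have h1 := columnMoment_reflection μ s hab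
  rw [columnMoment_diag μ s b a] at h1
  linear_combination (-625 / 576) * h1

lemma sum_columnMoment [IsProbabilityMeasure μ] (s : Fin d) :
    ∑ a, ∑ b, columnMoment μ s a b a b = 1 := by
  have hcol (U : unitaryGroup (Fin d) ℂ) : ∑ i, U.1 i s * star (U.1 i s) = 1 := by
    have h := congrFun₂ (mem_unitaryGroup_iff'.1 U.2) s s
    simpa [mul_apply, star_apply, mul_comm] using h
  simp only [columnMoment]
  simp_rw [← integral_finsetSum _ fun b _ => integrable_columnMoment μ s _ b _ b]
  rw [← integral_finsetSum _ fun a _ => integrable_finsetSum _ fun b _ =>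
    integrable_columnMoment μ s a b a b]
  have h (U : unitaryGroup (Fin d) ℂ) :
      ∑ a, ∑ b, U.1 a s * U.1 b s * star (U.1 a s) * star (U.1 b s) = 1 := by
    rw [← one_mul (1 : ℂ), ← hcol U, Finset.sum_mul_sum]
    refine Finset.sum_congr rfl fun a _ => Finset.sum_congr rfl fun b _ => ?_
    ring
  simp only [h, integral_const, probReal_univ, one_smul]

lemma columnMoment_diag_eq [μ.IsMulLeftInvariant] [IsProbabilityMeasure μ] (s a : Fin d) :
    columnMoment μ s a a a a = 2 / (d * (d + 1)) := by
  have hd : (d : ℂ) ≠ 0 := Nat.cast_ne_zero.2 (Fin.pos a).ne'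
  have hd' : (d : ℂ) + 1 ≠ 0 := Nat.cast_add_one_ne_zero d
  have h (i j : Fin d) : columnMoment μ s i j i j =
      columnMoment μ s a a a a / 2 * (1 + if i = j then 1 else 0) := by
    split_ifs with hij
    · rw [← hij, columnMoment_diag μ s i a]
      ring
    · rw [columnMoment_pair μ s hij, columnMoment_diag μ s i a]
      ring
  have hsum := sum_columnMoment μ s
  generalize columnMoment μ s a a a a = α at h ⊢
  simp_rw [h, ← Finset.mul_sum, Finset.sum_add_distrib] at hsum
  simp at hsum
  field_simp
  linear_combination 2 * hsum

theorem columnMoment_eq [μ.IsMulLeftInvariant] [IsProbabilityMeasure μ] (s a b c e : Fin d) :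
    columnMoment μ s a b c e = ((if a = c ∧ b = e then 1 else 0) +
      if a = e ∧ b = c then 1 else 0) / (d * (d + 1)) := by
  by_cases h : a = c ∧ b = e
  · obtain ⟨rfl, rfl⟩ := h
    rcases eq_or_ne a b with rfl | hab
    · simp [columnMoment_diag_eq, one_add_one_eq_two]
    · rw [columnMoment_pair μ s hab, columnMoment_diag_eq]
      simp [hab]
      field_simp
  by_cases h' : a = e ∧ b = c
  · obtain ⟨rfl, rfl⟩ := h'
    have hab : a ≠ b := fun hab => h ⟨hab, hab.symm⟩
    rw [← columnMoment_swap_left, columnMoment_pair μ s hab.symm, columnMoment_diag_eq]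
    simp [hab]
    field_simp
  · simp [h, h', columnMoment_eq_zero μ s a b c e h h']

end ColumnMoment

lemma kronecker_self_mul_diagonal_mul_conjTranspose_apply {d : ℕ}
    (U : unitaryGroup (Fin d) ℂ) (x : ℂ) (p q : Fin d × Fin d) :
    ((U.1 ⊗ₖ U.1) * diagonal (fun st : Fin d × Fin d => if st.1 = st.2 then x else 1) *
      (U.1 ⊗ₖ U.1)ᴴ) p q = (1 : Matrix (Fin d × Fin d) (Fin d × Fin d) ℂ) p q +
      (x - 1) * ∑ s, U.1 p.1 s * U.1 p.2 s * star (U.1 q.1 s) * star (U.1 q.2 s) := by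
  have hY : diagonal (fun st : Fin d × Fin d => if st.1 = st.2 then x else 1) =
      1 + (x - 1) • diagonal (fun st : Fin d × Fin d => if st.1 = st.2 then (1 : ℂ) else 0) := by
    rw [← diagonal_one, ← diagonal_smul, diagonal_add]
    congr 1 with st
    by_cases h : st.1 = st.2 <;> simp [h]
  have hU : (U.1 ⊗ₖ U.1) * (U.1 ⊗ₖ U.1)ᴴ = 1 := by
    rw [conjTranspose_kronecker, ← mul_kronecker_mul, ← star_eq_conjTranspose,
      mem_unitaryGroup_iff.1 U.2, one_kronecker_one]
  rw [hY, mul_add, add_mul, mul_one, hU, Matrix.add_apply, Matrix.mul_smul, Matrix.smul_mul, Matrix.smul_apply,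
    smul_eq_mul]
  congr 2
  rw [mul_apply, Fintype.sum_prod_type]
  refine Finset.sum_congr rfl fun s _ => ?_
  simp [mul_diagonal, mul_assoc]

/-- Second-order twirling of the entrywise square `Y` of the purity
post-processing matrix (diagonal entries `d²` on diagonal pairs and `1` off-diagonal pairs):
for Haar-random `U ∈ U(d)`, `∫ U^{⊗2} Y (U^{⊗2})† dμ(U) = d·I + (d−1)·S` (entrywise),
where `S` is the swap operator. -/
theorem twirl_X2sq_eq_id_add_swap {d : ℕ} (hd : 1 ≤ d)
    (μ : Measure (Matrix.unitaryGroup (Fin d) ℂ))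
    [μ.IsHaarMeasure] [IsProbabilityMeasure μ] :
    ∀ p q : Fin d × Fin d,
      (∫ U : Matrix.unitaryGroup (Fin d) ℂ,
        ((((U : Matrix (Fin d) (Fin d) ℂ) ⊗ₖ (U : Matrix (Fin d) (Fin d) ℂ)) *
          Matrix.diagonal (fun st : Fin d × Fin d => if st.1 = st.2 then (d : ℂ) ^ 2 else 1) *
          (((U : Matrix (Fin d) (Fin d) ℂ) ⊗ₖ (U : Matrix (Fin d) (Fin d) ℂ)))ᴴ) p q) ∂μ) =
      (((d : ℂ) • (1 : Matrix (Fin d × Fin d) (Fin d × Fin d) ℂ) +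
        ((d : ℂ) - 1) • Matrix.of
          (fun p q : Fin d × Fin d => if p.1 = q.2 ∧ p.2 = q.1 then (1 : ℂ) else 0) :
        Matrix (Fin d × Fin d) (Fin d × Fin d) ℂ) p q) := by
  rintro ⟨a, b⟩ ⟨c, e⟩
  have hd0 : (d : ℂ) ≠ 0 := Nat.cast_ne_zero.2 (by lia)
  have hd1 : (d : ℂ) + 1 ≠ 0 := Nat.cast_add_one_ne_zero d
  have hI := integrable_columnMoment μ
  have hsum : ∫ U : unitaryGroup (Fin d) ℂ,
      ∑ s, U.1 a s * U.1 b s * star (U.1 c s) * star (U.1 e s) ∂μ =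
      ∑ s, columnMoment μ s a b c e := integral_finsetSum _ fun s _ => hI s a b c e
  simp_rw [kronecker_self_mul_diagonal_mul_conjTranspose_apply]
  rw [integral_add (integrable_const _)
    ((integrable_finsetSum _ fun s _ => hI s a b c e).const_mul _), integral_const_mul, hsum]
  simp only [columnMoment_eq, integral_const, probReal_univ, one_smul, Finset.sum_const,
    Finset.card_univ, Fintype.card_fin, nsmul_eq_mul, Matrix.add_apply, Matrix.smul_apply,
    one_apply, Prod.mk.injEq, of_apply, smul_eq_mul]
  field_simp
  ring
end
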